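/- arXiv:2505.13142 — 2 statements merged into one kernel-verified Lean document; each statement's English description precedes it below -/
import Mathlib

section
/- Let d, s ≥ 1 be integers and n_s ≥ 3. There exists a constant C > 0, depending only on d and s, such that for every function f̂ that is s-times continuously differentiable on a neighborhood of the closed Euclidean unit ball B^d = {x ∈ ℝ^d : ‖x‖₂ ≤ 1} with max_{|α| ≤ s} sup_{x ∈ B^d} |D^α f̂(x)| ≤ 1, and every N ≥ 1, there exists a shallow PLN-Net f of norm size n_s and width n_s·N from ℝ^d to ℝ such that sup_{x ∈ B^d} |f(x) − f̂(x)| ≤ C·N^{−s/d}. -/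
/-- Layer normalization on `ℝ^n`: `LN(h)ⱼ = (hⱼ − μ)/σ` when `σ ≠ 0`, and `0` when `σ = 0`. -/
noncomputable def LN {n : ℕ} (h : Fin n → ℝ) : Fin n → ℝ :=
  let μ : ℝ := (∑ i, h i) / n
  let σ : ℝ := Real.sqrt ((∑ i, (h i - μ) ^ 2) / n)
  if σ = 0 then 0 else fun j => (h j - μ) / σ

/-- Parallel layer normalization: `N` consecutive blocks of size `ns`, `LN` on each. -/
noncomputable def PLN (ns N : ℕ) (h : Fin (N * ns) → ℝ) : Fin (N * ns) → ℝ :=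
  fun i => LN (fun j : Fin ns => h (finProdFinEquiv (i.divNat, j))) i.modNat

/-- Partial derivative in the `i`-th coordinate direction. -/
noncomputable def pderiv' {d : ℕ} (i : Fin d) (f : (Fin d → ℝ) → ℝ) : (Fin d → ℝ) → ℝ :=
  fun x => fderiv ℝ f x (Pi.single i (1:ℝ))

/-- Multi-index partial derivative `D^α`. -/
noncomputable def mpderiv {d : ℕ} (α : Fin d → ℕ) (f : (Fin d → ℝ) → ℝ) :
    (Fin d → ℝ) → ℝ :=
  ((List.ofFn fun i : Fin d => (pderiv' i)^[α i]).foldr (· ∘ ·) id) f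



section ClassW

variable {E : Type*} [NormedAddCommGroup E] [InnerProductSpace ℝ E]

/-- Distance of an isometry to the identity. -/
noncomputable def nd (R : E ≃ₗᵢ[ℝ] E) : ℝ :=
  ‖((R.toContinuousLinearEquiv : E →L[ℝ] E) - ContinuousLinearMap.id ℝ E)‖

lemma nd_nonneg (R : E ≃ₗᵢ[ℝ] E) : 0 ≤ nd R := norm_nonneg _

lemma nd_apply (R : E ≃ₗᵢ[ℝ] E) (x : E) : ‖R x - x‖ ≤ nd R * ‖x‖ := by
  simpa [nd] using
    ((R.toContinuousLinearEquiv : E →L[ℝ] E) - ContinuousLinearMap.id ℝ E).le_opNorm x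

lemma nd_le_of (R : E ≃ₗᵢ[ℝ] E) (c : ℝ) (hc : 0 ≤ c) (h : ∀ x, ‖R x - x‖ ≤ c * ‖x‖) :
    nd R ≤ c := by
  unfold nd
  exact ContinuousLinearMap.opNorm_le_bound _ hc (fun x => by simpa using h x)

lemma nd_le_two (R : E ≃ₗᵢ[ℝ] E) : nd R ≤ 2 := by
  apply nd_le_of _ _ (by norm_num)
  intro x
  calc ‖R x - x‖ ≤ ‖R x‖ + ‖x‖ := norm_sub_le _ _
    _ = 2 * ‖x‖ := by rw [R.norm_map]; ring

/-- Smoothness class on the unit sphere measured by iterated rotational differences. -/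
def Wc : ℕ → ℝ → (E → ℝ) → Prop
  | 0, M, F => ∀ x, ‖x‖ = 1 → |F x| ≤ M
  | s + 1, M, F => (∀ x, ‖x‖ = 1 → |F x| ≤ M) ∧
      ∀ R : E ≃ₗᵢ[ℝ] E, Wc s (M * nd R) (fun x => F (R x) - F x)

lemma Wc.bound {s : ℕ} {M : ℝ} {F : E → ℝ} (h : Wc s M F) : ∀ x, ‖x‖ = 1 → |F x| ≤ M := by
  cases s with
  | zero => exact h
  | succ s => exact h.1

lemma Wc.mono {s : ℕ} : ∀ {M M' : ℝ} {F : E → ℝ}, Wc s M F → M ≤ M' → Wc s M' F := by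
  induction s with
  | zero => intro M M' F h hM x hx; exact (h x hx).trans hM
  | succ s ih =>
    intro M M' F h hM
    refine ⟨fun x hx => (h.1 x hx).trans hM, fun R => ih (h.2 R) ?_⟩
    exact mul_le_mul_of_nonneg_right hM (nd_nonneg R)

lemma Wc.congr {s : ℕ} : ∀ {M : ℝ} {F G : E → ℝ}, Wc s M F → (∀ x, ‖x‖ = 1 → F x = G x) →
    Wc s M G := by
  induction s with
  | zero => intro M F G h hM x hx; rw [← hM x hx]; exact h x hx
  | succ s ih =>
    intro M F G h hM
    refine ⟨fun x hx => by rw [← hM x hx]; exact h.1 x hx, fun R => ih (h.2 R) ?_⟩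
    intro x hx
    rw [hM x hx, hM (R x) (by rw [R.norm_map, hx])]

lemma Wc.down {s : ℕ} : ∀ {M : ℝ} {F : E → ℝ}, Wc (s + 1) M F → Wc s M F := by
  induction s with
  | zero => intro M F h; exact h.1
  | succ s ih => intro M F h; exact ⟨h.1, fun R => ih (h.2 R)⟩

lemma Wc.add {s : ℕ} : ∀ {M M' : ℝ} {F G : E → ℝ}, Wc s M F → Wc s M' G →
    Wc s (M + M') (fun x => F x + G x) := by
  induction s with
  | zero => intro M M' F G h h' x hx; exact (abs_add_le _ _).trans (add_le_add (h x hx) (h' x hx))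
  | succ s ih =>
    intro M M' F G h h'
    refine ⟨fun x hx => (abs_add_le _ _).trans (add_le_add (h.1 x hx) (h'.1 x hx)), fun R => ?_⟩
    have := ih (h.2 R) (h'.2 R)
    rw [add_mul]
    exact this.congr (fun x _ => by ring)

lemma Wc.zero {s : ℕ} : Wc s 0 (fun _ : E => (0:ℝ)) := by
  induction s with
  | zero => intro x hx; simp
  | succ s ih => exact ⟨fun x hx => by simp, fun R => by simpa using ih⟩

lemma Wc.sum {s : ℕ} {ι : Type*} (t : Finset ι) (M : ι → ℝ) (F : ι → E → ℝ)
    (h : ∀ i ∈ t, Wc s (M i) (F i)) : Wc s (∑ i ∈ t, M i) (fun x => ∑ i ∈ t, F i x) := by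
  classical
  induction t using Finset.induction_on with
  | empty => simpa using Wc.zero
  | insert a t ha ih =>
    simp only [Finset.sum_insert ha]
    exact (h a (by simp)).add (ih fun i hi => h i (by simp [hi]))

lemma Wc.mul {s : ℕ} : ∀ {M M' : ℝ} {F G : E → ℝ}, 0 ≤ M → 0 ≤ M' → Wc s M F → Wc s M' G →
    Wc s (4 ^ s * (M * M')) (fun x => F x * G x) := by
  induction s with
  | zero =>
    intro M M' F G hM hM' h h' x hx
    rw [abs_mul, pow_zero, one_mul]
    exact mul_le_mul (h x hx) (h' x hx) (abs_nonneg _) hM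
  | succ s ih =>
    intro M M' F G hM hM' h h'
    have h4 : (1:ℝ) ≤ 4 ^ (s + 1) := one_le_pow₀ (by norm_num)
    refine ⟨fun x hx => ?_, fun R => ?_⟩
    · rw [abs_mul]
      have := mul_le_mul (h.1 x hx) (h'.1 x hx) (abs_nonneg _) hM
      have h2 : 0 ≤ M * M' := mul_nonneg hM hM'
      nlinarith
    · have n0 := nd_nonneg R
      have n2 := nd_le_two R
      have a1 := ih hM (mul_nonneg hM' n0) h.down (h'.2 R)
      have a2 := ih (mul_nonneg hM n0) hM' (h.2 R) h'.down
      have a3 := ih (mul_nonneg hM n0) (mul_nonneg hM' n0) (h.2 R) (h'.2 R)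
      refine (((a1.add a2).add a3).congr (G := fun x => F (R x) * G (R x) - F x * G x)
        (fun x _ => by ring)).mono ?_
      have : 0 ≤ 4 ^ s * (M * M' * nd R) := by positivity
      have h3 : 4 ^ s * (M * nd R * (M' * nd R)) = 4 ^ s * (M * M' * nd R) * nd R := by ring
      rw [h3, pow_succ]
      nlinarith

lemma Wc.lin {s : ℕ} : ∀ {m : ℝ} (l : E →ₗ[ℝ] ℝ), (∀ x, |l x| ≤ m * ‖x‖) →
    Wc s m (fun x => l x) := by
  induction s with
  | zero => intro m l h x hx; simpa [hx] using h x
  | succ s ih =>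
    intro m l h
    refine ⟨fun x hx => by simpa [hx] using h x, fun R => ?_⟩
    have := @ih (m * nd R) (l ∘ₗ (R.toLinearEquiv.toLinearMap - LinearMap.id)) (fun x => by
      have h1 := h (R x - x)
      have h2 := nd_apply R x
      have hm : 0 ≤ m * ‖x‖ := (abs_nonneg _).trans (h x)
      simp only [LinearMap.comp_apply, LinearMap.sub_apply, LinearMap.id_apply]
      refine le_trans h1 ?_
      rcases eq_or_ne x 0 with rfl | hx
      · simp
      · have : 0 ≤ m := by
          have : 0 < ‖x‖ := norm_pos_iff.2 hx
          by_contra hh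
          push Not at hh
          nlinarith
        rw [mul_assoc]
        exact mul_le_mul_of_nonneg_left h2 this)
    exact this.congr (fun x _ => by simp)

lemma Wc.avg {s : ℕ} : ∀ {M : ℝ} (F : ℝ → E → ℝ), (∀ t ∈ Set.Icc (0:ℝ) 1, Wc s M (F t)) →
    (∀ x, ‖x‖ = 1 → IntervalIntegrable (fun t => F t x) MeasureTheory.volume 0 1) →
    Wc s M (fun x => ∫ t in (0:ℝ)..1, F t x) := by
  have key : ∀ {M : ℝ} (F : ℝ → E → ℝ) x, (∀ t ∈ Set.Icc (0:ℝ) 1, |F t x| ≤ M) →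
      |∫ t in (0:ℝ)..1, F t x| ≤ M := by
    intro M F x h
    have := intervalIntegral.norm_integral_le_of_norm_le_const (a := 0) (b := 1) (C := M)
      (f := fun t => F t x) (fun t ht => by
        rw [Set.uIoc_of_le (by norm_num)] at ht
        exact h t ⟨ht.1.le, ht.2⟩)
    simpa using this
  induction s with
  | zero => intro M F h hi x hx; exact key F x (fun t ht => h t ht x hx)
  | succ s ih =>
    intro M F h hi
    refine ⟨fun x hx => key F x (fun t ht => (h t ht).1 x hx), fun R => ?_⟩
    have := ih (fun t x => F t (R x) - F t x) (fun t ht => (h t ht).2 R) (fun x hx =>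
      (hi (R x) (by rw [R.norm_map, hx])).sub (hi x hx))
    refine this.congr (fun x hx => ?_)
    exact intervalIntegral.integral_sub (hi (R x) (by rw [R.norm_map, hx])) (hi x hx)

end ClassW


section Deriv

/-- Iterated partial derivatives along a list of coordinate indices. -/
noncomputable def pl {d : ℕ} (L : List (Fin d)) (f : (Fin d → ℝ) → ℝ) : (Fin d → ℝ) → ℝ :=
  L.foldr pderiv' f

lemma pderiv'_contDiffOn {d : ℕ} {U : Set (Fin d → ℝ)} (hU : IsOpen U) {k : ℕ}
    {f : (Fin d → ℝ) → ℝ} (h : ContDiffOn ℝ (k + 1 : ℕ) f U) (i : Fin d) :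
    ContDiffOn ℝ k (pderiv' i f) U := by
  have h1 : ContDiffOn ℝ k (fderiv ℝ f) U := h.fderiv_of_isOpen hU (by norm_cast)
  exact h1.clm_apply contDiffOn_const

lemma pderiv'_congr {d : ℕ} {U : Set (Fin d → ℝ)} (hU : IsOpen U)
    {f g : (Fin d → ℝ) → ℝ} (h : Set.EqOn f g U) (i : Fin d) :
    Set.EqOn (pderiv' i f) (pderiv' i g) U := by
  intro x hx
  have : f =ᶠ[nhds x] g := Filter.eventuallyEq_of_mem (hU.mem_nhds hx) h
  simp only [pderiv', this.fderiv_eq]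

lemma pl_contDiffOn {d : ℕ} {U : Set (Fin d → ℝ)} (hU : IsOpen U)
    {f : (Fin d → ℝ) → ℝ} (L : List (Fin d)) : ∀ {k : ℕ}
    (_ : ContDiffOn ℝ (k + L.length : ℕ) f U), ContDiffOn ℝ k (pl L f) U := by
  induction L with
  | nil => intro k h; simpa [pl] using h
  | cons i L ih =>
    intro k h
    have : ContDiffOn ℝ (k + 1 : ℕ) (pl L f) U := ih (by
      rw [List.length_cons] at h
      convert h using 2
      ring)
    exact pderiv'_contDiffOn hU this i

lemma pderiv'_comm {d : ℕ} {U : Set (Fin d → ℝ)} (hU : IsOpen U)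
    {f : (Fin d → ℝ) → ℝ} (h : ContDiffOn ℝ (2 : ℕ) f U) (i j : Fin d) :
    Set.EqOn (pderiv' i (pderiv' j f)) (pderiv' j (pderiv' i f)) U := by
  intro x hx
  have hc : ContDiffAt ℝ (2 : ℕ) f x := h.contDiffAt (hU.mem_nhds hx)
  have hs : IsSymmSndFDerivAt ℝ f x := hc.isSymmSndFDerivAt (by simp)
  have hd : DifferentiableAt ℝ (fderiv ℝ f) x :=
    (hc.fderiv_right (m := 1) (by norm_num)).differentiableAt (by norm_num)
  have key : ∀ a b : Fin d, pderiv' a (pderiv' b f) x =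
      fderiv ℝ (fderiv ℝ f) x (Pi.single a 1) (Pi.single b 1) := by
    intro a b
    have : HasFDerivAt (pderiv' b f)
        ((ContinuousLinearMap.apply ℝ ℝ (Pi.single b (1:ℝ))).comp (fderiv ℝ (fderiv ℝ f) x)) x := by
      exact (ContinuousLinearMap.apply ℝ ℝ (Pi.single b (1:ℝ))).hasFDerivAt.comp x hd.hasFDerivAt
    rw [pderiv', this.fderiv]
    simp
  rw [key, key]
  exact hs _ _

lemma pl_perm {d : ℕ} {U : Set (Fin d → ℝ)} (hU : IsOpen U)
    {f : (Fin d → ℝ) → ℝ} {L L' : List (Fin d)} (hp : L.Perm L') :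
    ContDiffOn ℝ (L.length : ℕ) f U → Set.EqOn (pl L f) (pl L' f) U := by
  induction hp with
  | nil => intro _ x hx; rfl
  | cons i hp ih =>
    intro h
    exact pderiv'_congr hU (ih (h.of_le (by simp))) i
  | swap i j L =>
    intro h
    refine pderiv'_comm hU (f := pl L f) (pl_contDiffOn hU L ?_) j i
    convert h using 2
    simp; ring
  | trans h1 h2 ih1 ih2 =>
    intro h
    exact (ih1 h).trans (ih2 (by rwa [← h1.length_eq]))

/-- The list of indices attached to a multi-index. -/
def flatIdx {d : ℕ} (α : Fin d → ℕ) : List (Fin d) :=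
  ((List.finRange d).map fun i => List.replicate (α i) i).flatten

lemma pl_append {d : ℕ} (L L' : List (Fin d)) (f : (Fin d → ℝ) → ℝ) :
    pl (L ++ L') f = pl L (pl L' f) := by simp [pl]

lemma pl_replicate {d : ℕ} (i : Fin d) (n : ℕ) (f : (Fin d → ℝ) → ℝ) :
    pl (List.replicate n i) f = (pderiv' i)^[n] f := by
  induction n with
  | zero => rfl
  | succ n ih =>
    rw [List.replicate_succ, Function.iterate_succ_apply', ← ih]; rfl

lemma mpderiv_eq_pl {d : ℕ} (α : Fin d → ℕ) (f : (Fin d → ℝ) → ℝ) :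
    mpderiv α f = pl (flatIdx α) f := by
  unfold mpderiv flatIdx
  rw [List.ofFn_eq_map]
  induction (List.finRange d) with
  | nil => rfl
  | cons i L ih =>
    simp only [List.map_cons, List.foldr_cons, List.flatten_cons, pl_append, Function.comp_apply]
    rw [ih, pl_replicate]

lemma flatIdx_perm {d : ℕ} (L : List (Fin d)) : (flatIdx fun i => L.count i).Perm L := by
  rw [List.perm_iff_count]
  intro a
  unfold flatIdx
  rw [List.count_flatten, List.map_map]
  have : (List.count a ∘ fun i => List.replicate (List.count i L) i) =
      fun i => if i = a then L.count a else 0 := by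
    funext i
    by_cases h : i = a
    · subst h; simp
    · simp [List.count_replicate, h]
  rw [this, ← List.sum_toFinset _ (List.nodup_finRange d)]
  simp

/-- Smooth functions with derivatives bounded by one on the ball. -/
def Good {d : ℕ} (U : Set (Fin d → ℝ)) (k : ℕ) (f : (Fin d → ℝ) → ℝ) : Prop :=
  ContDiffOn ℝ k f U ∧ ∀ L : List (Fin d), L.length ≤ k → ∀ x : Fin d → ℝ,
    (∑ i, (x i) ^ 2) ≤ 1 → |pl L f x| ≤ 1

lemma good_of {d s : ℕ} {U : Set (Fin d → ℝ)} (hU : IsOpen U)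
    (hB : {x : Fin d → ℝ | (∑ i, (x i) ^ 2) ≤ 1} ⊆ U) {f : (Fin d → ℝ) → ℝ}
    (hf : ContDiffOn ℝ s f U)
    (h : ∀ α : Fin d → ℕ, (∑ i, α i) ≤ s →
        ∀ x : Fin d → ℝ, (∑ i, (x i) ^ 2) ≤ 1 → |mpderiv α f x| ≤ 1) : Good U s f := by
  refine ⟨hf, fun L hL x hx => ?_⟩
  have h1 := h (fun i => L.count i) (by
    have : ∑ i, L.count i = L.length := by
      have := Multiset.toFinset_sum_count_eq (L : Multiset (Fin d))
      rw [← Multiset.coe_card, ← this]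
      simp only [Multiset.coe_count]
      symm
      apply Finset.sum_subset (Finset.subset_univ _)
      intro i _ hi
      rw [List.count_eq_zero]
      simpa using hi
    omega) x hx
  rw [mpderiv_eq_pl] at h1
  rwa [pl_perm hU (flatIdx_perm L) (hf.of_le (by
    rw [(flatIdx_perm L).length_eq]; exact_mod_cast hL)) (hB hx)] at h1

lemma Good.pderiv {d k : ℕ} {U : Set (Fin d → ℝ)} (hU : IsOpen U) {f : (Fin d → ℝ) → ℝ}
    (h : Good U (k + 1) f) (i : Fin d) : Good U k (pderiv' i f) := by
  refine ⟨pderiv'_contDiffOn hU h.1 i, fun L hL x hx => ?_⟩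
  have := h.2 (L ++ [i]) (by simpa using hL) x hx
  rwa [pl_append] at this

/-- Constants for the regularity of compositions. -/
noncomputable def cB (d : ℕ) : ℕ → ℝ
  | 0 => 1
  | k + 1 => 1 + d * (4 ^ k * cB d k)

lemma cB_pos (d k : ℕ) : 0 < cB d k := by
  induction k with
  | zero => norm_num [cB]
  | succ k ih => rw [cB]; positivity

variable {E : Type*} [NormedAddCommGroup E] [InnerProductSpace ℝ E]

lemma good_Wc {d : ℕ} {U : Set (Fin d → ℝ)} (hU : IsOpen U)
    (hB : {x : Fin d → ℝ | (∑ i, (x i) ^ 2) ≤ 1} ⊆ U) (k : ℕ) :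
    ∀ {f : (Fin d → ℝ) → ℝ} (_ : Good U k f) (A : E →L[ℝ] (Fin d → ℝ))
      (_ : ∀ x, ∑ i, (A x i) ^ 2 ≤ ‖x‖ ^ 2), Wc k (cB d k) (fun x => f (A x)) := by
  have h0 : ∀ {k : ℕ} {f : (Fin d → ℝ) → ℝ} (_ : Good U k f) (A : E →L[ℝ] (Fin d → ℝ))
      (_ : ∀ x, ∑ i, (A x i) ^ 2 ≤ ‖x‖ ^ 2) x, ‖x‖ = 1 → |f (A x)| ≤ 1 := by
    intro k f hf A hA x hx
    exact hf.2 [] (by simp) _ ((hA x).trans (by simp [hx]))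
  induction k with
  | zero => intro f hf A hA x hx; exact h0 hf A hA x hx
  | succ k ih =>
    intro f hf A hA
    have hc := cB_pos d k
    refine ⟨fun x hx => (h0 hf A hA x hx).trans ?_, fun R => ?_⟩
    · rw [cB]; have : 0 ≤ d * (4 ^ k * cB d k) := by positivity
      linarith
    · let At : ℝ → E →L[ℝ] (Fin d → ℝ) := fun t =>
        A.comp ((1 - t) • ContinuousLinearMap.id ℝ E + t • (R.toContinuousLinearEquiv : E →L[ℝ] E))
      have hAtx : ∀ t x, At t x = A x + t • A (R x - x) := by
        intro t x
        simp only [At, ContinuousLinearMap.comp_apply, add_apply,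
          smul_apply, ContinuousLinearMap.id_apply]
        have hr : (R.toContinuousLinearEquiv : E →L[ℝ] E) x = R x := rfl
        rw [hr, ← map_smul A, ← map_add A]
        congr 1
        module
      have hAt : ∀ t ∈ Set.Icc (0:ℝ) 1, ∀ x, ∑ i, (At t x i) ^ 2 ≤ ‖x‖ ^ 2 := by
        intro t ht x
        have hr : (R.toContinuousLinearEquiv : E →L[ℝ] E) x = R x := rfl
        have hn : ‖(1 - t) • x + t • R x‖ ≤ ‖x‖ := by
          refine (norm_add_le _ _).trans ?_
          rw [norm_smul, norm_smul, R.norm_map, Real.norm_eq_abs, Real.norm_eq_abs,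
            abs_of_nonneg ht.1, abs_of_nonneg (sub_nonneg.2 ht.2)]
          apply le_of_eq; ring
        have he : At t x = A ((1 - t) • x + t • R x) := by
          rw [hAtx, ← map_smul, ← map_add]
          congr 1
          module
        rw [he]
        refine (hA _).trans ?_
        gcongr
      have hlin : ∀ i : Fin d, Wc k (nd R) (fun x => A (R x - x) i) := by
        intro i
        refine (Wc.lin (m := nd R) (((ContinuousLinearMap.proj (R := ℝ) i).comp A).toLinearMap ∘ₗ
          (R.toLinearEquiv.toLinearMap - LinearMap.id)) ?_).congr (fun x _ => by simp)
        intro x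
        have h1 : (A (R x - x) i) ^ 2 ≤ ‖R x - x‖ ^ 2 :=
          (Finset.single_le_sum (f := fun i => (A (R x - x) i) ^ 2) (fun i _ => sq_nonneg _)
            (Finset.mem_univ i)).trans (hA _)
        have h2 := abs_le_of_sq_le_sq h1 (norm_nonneg _)
        exact le_trans (by simpa using h2) (nd_apply R x)
      have hball : ∀ t ∈ Set.Icc (0:ℝ) 1, ∀ x, ‖x‖ = 1 → At t x ∈ U := fun t ht x hx =>
        hB (by simpa [hx] using hAt t ht x)
      have hcont : ∀ x, Continuous fun t => At t x := by
        intro x; simp only [hAtx]; fun_prop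
      have hi : ∀ x, ‖x‖ = 1 → ContinuousOn
          (fun t => ∑ i, pderiv' i f (At t x) * A (R x - x) i) (Set.Icc 0 1) := by
        intro x hx
        apply continuousOn_finsetSum
        intro i _
        refine ContinuousOn.mul ?_ continuousOn_const
        exact (hf.pderiv hU i).1.continuousOn.comp (hcont x).continuousOn
          (fun t ht => hball t ht x hx)
      have hii : ∀ x, ‖x‖ = 1 → IntervalIntegrable
          (fun t => ∑ i, pderiv' i f (At t x) * A (R x - x) i) MeasureTheory.volume 0 1 := by
        intro x hx
        apply ContinuousOn.intervalIntegrable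
        rw [Set.uIcc_of_le zero_le_one]
        exact hi x hx
      have main := Wc.avg (s := k) (M := ∑ _i : Fin d, 4 ^ k * (cB d k * nd R))
        (fun t x => ∑ i, pderiv' i f (At t x) * A (R x - x) i) (fun t ht =>
          Wc.sum _ _ _ (fun i _ => Wc.mul hc.le (nd_nonneg R)
            (ih (hf.pderiv hU i) (At t) (hAt t ht)) (hlin i))) hii
      refine (main.congr ?_).mono ?_
      · intro x hx
        have hder : ∀ t ∈ Set.uIcc (0:ℝ) 1, HasDerivAt (fun t => f (At t x))
            (∑ i, pderiv' i f (At t x) * A (R x - x) i) t := by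
          intro t ht
          rw [Set.uIcc_of_le zero_le_one] at ht
          have hfd : HasFDerivAt f (fderiv ℝ f (At t x)) (At t x) :=
            ((hf.1.contDiffAt (hU.mem_nhds (hball t ht x hx))).differentiableAt
              (by simp)).hasFDerivAt
          have hA' : HasDerivAt (fun t => At t x) (A (R x - x)) t := by
            simp only [hAtx]
            simpa using ((hasDerivAt_id t).smul_const (A (R x - x))).const_add (A x)
          have := hfd.comp_hasDerivAt t hA'
          refine this.congr_deriv ?_
          conv_lhs => rw [← Finset.univ_sum_single (A (R x - x)), map_sum]
          refine Finset.sum_congr rfl fun i _ => ?_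
          have : (Pi.single i (A (R x - x) i) : Fin d → ℝ) =
              (A (R x - x) i) • Pi.single i (1:ℝ) := by
            rw [← Pi.single_smul]; simp
          rw [this, map_smul, pderiv', smul_eq_mul, mul_comm]
        rw [intervalIntegral.integral_eq_sub_of_hasDerivAt hder (hii x hx)]
        simp [hAtx]
      · simp only [Finset.sum_const, Finset.card_univ, Fintype.card_fin, nsmul_eq_mul]
        rw [cB]
        have := nd_nonneg R
        nlinarith

end Deriv


section SphMeas
set_option linter.unusedSectionVars false
open MeasureTheory Metric Module
open scoped Pointwise

variable {E : Type*} [NormedAddCommGroup E] [InnerProductSpace ℝ E] [FiniteDimensional ℝ E]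
  [MeasurableSpace E] [BorelSpace E]

/-- A rotation invariant measure concentrated on the unit sphere. -/
noncomputable def sph (E : Type*) [NormedAddCommGroup E] [InnerProductSpace ℝ E]
    [FiniteDimensional ℝ E] [MeasurableSpace E] [BorelSpace E] : Measure E :=
  ((volume : Measure E).restrict (ball 0 1)).map (fun y => ‖y‖⁻¹ • y)

lemma nrm_meas : Measurable (fun y : E => ‖y‖⁻¹ • y) := measurable_norm.inv.smul measurable_id

instance : IsFiniteMeasure (sph E) := by
  have : IsFiniteMeasure ((volume : Measure E).restrict (ball 0 1)) :=
    ⟨by simpa using measure_ball_lt_top⟩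
  unfold sph; infer_instance

lemma sph_real_apply {s : Set E} (hs : MeasurableSet s) :
    (sph E).real s = volume.real {y : E | ‖y‖⁻¹ • y ∈ s ∧ ‖y‖ < 1} := by
  unfold sph
  rw [measureReal_def, Measure.map_apply nrm_meas hs, Measure.restrict_apply (nrm_meas hs),
    measureReal_def]
  congr 2
  ext y; simp

lemma sph_sphere [Nontrivial E] : ∀ᵐ y ∂(sph E), ‖y‖ = 1 := by
  unfold sph
  rw [ae_map_iff nrm_meas.aemeasurable (measurableSet_eq_fun measurable_norm measurable_const)]
  apply ae_restrict_of_ae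
  have : ∀ᵐ y ∂(volume : Measure E), y ≠ 0 := by
    have := measure_singleton (μ := (volume : Measure E)) 0
    rw [ae_iff]; simp
  filter_upwards [this] with y hy
  rw [norm_smul, norm_inv, norm_norm, inv_mul_cancel₀ (norm_ne_zero_iff.2 hy)]

lemma sph_inv (R : E ≃ₗᵢ[ℝ] E) : MeasurePreserving R (sph E) (sph E) := by
  refine ⟨R.continuous.measurable, ?_⟩
  unfold sph
  rw [Measure.map_map R.continuous.measurable nrm_meas]
  have h1 : (R : E → E) ∘ (fun y : E => ‖y‖⁻¹ • y) = (fun y : E => ‖y‖⁻¹ • y) ∘ R := by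
    funext y; simp
  rw [h1, ← Measure.map_map nrm_meas R.continuous.measurable]
  congr 1
  have h2 := (R.measurePreserving.restrict_preimage (s := ball (0:E) 1) measurableSet_ball).map_eq
  have h3 : (R : E → E) ⁻¹' (ball 0 1) = ball 0 1 := by ext y; simp
  rwa [h3] at h2

/-- Cone over a cap. -/
def cone (x : E) (l : ℝ) : Set E := {y : E | ‖y‖⁻¹ • y ∈ closedBall x l ∧ ‖y‖ < 1}

lemma cone_meas (x : E) (l : ℝ) : MeasurableSet (cone x l) :=
  (nrm_meas measurableSet_closedBall).inter (measurableSet_lt measurable_norm measurable_const)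

lemma cone_fin (x : E) (l : ℝ) : volume (cone x l) ≠ ⊤ :=
  ((measure_mono (fun y hy => by simpa using hy.2)).trans_lt
    (measure_ball_lt_top (x := (0:E)) (r := 1))).ne

lemma cone_annulus (x : E) {l : ℝ} (h0 : 0 < l) (h1 : l < 1) :
    volume.real (cone x l \ (1 - l) • cone x l) =
      (1 - (1 - l) ^ finrank ℝ E) * volume.real (cone x l) := by
  have hsub : (1 - l) • cone x l ⊆ cone x l := by
    rintro _ ⟨y, hy, rfl⟩
    have hp : 0 < 1 - l := by linarith
    refine ⟨?_, ?_⟩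
    · have : ‖(1 - l) • y‖⁻¹ • (1 - l) • y = ‖y‖⁻¹ • y := by
        rw [norm_smul, Real.norm_eq_abs, abs_of_pos hp, mul_inv, smul_smul]
        congr 1
        field_simp
      show ‖(1 - l) • y‖⁻¹ • (1 - l) • y ∈ _
      rw [this]; exact hy.1
    · show ‖(1 - l) • y‖ < 1
      rw [norm_smul, Real.norm_eq_abs, abs_of_pos hp]
      have := hy.2
      nlinarith [norm_nonneg y]
  rw [measureReal_sdiff hsub ((cone_meas x l).const_smul₀ _) (by
    exact cone_fin x l)]
  have : volume.real ((1 - l) • cone x l) = (1 - l) ^ finrank ℝ E * volume.real (cone x l) := by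
    rw [measureReal_def, Measure.addHaar_smul, ENNReal.toReal_mul, ENNReal.toReal_ofReal (abs_nonneg _),
      abs_of_nonneg (pow_nonneg (by linarith) _), measureReal_def]
  rw [this]; ring

lemma vball (x : E) {r : ℝ} (hr : 0 ≤ r) :
    volume.real (closedBall x r) = r ^ finrank ℝ E * volume.real (ball (0:E) 1) := by
  rw [measureReal_def, Measure.addHaar_closedBall _ _ hr, ENNReal.toReal_mul,
    ENNReal.toReal_ofReal (pow_nonneg hr _), measureReal_def]

lemma not_mem_smul_cone {x y : E} {l : ℝ} (h1 : l < 1) (h : y ∉ (1 - l) • cone x l)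
    (hy : y ∈ cone x l) : 1 - l ≤ ‖y‖ := by
  by_contra hh
  push Not at hh
  apply h
  have hp : 0 < 1 - l := by linarith
  refine ⟨(1 - l)⁻¹ • y, ⟨?_, ?_⟩, ?_⟩
  · have : ‖(1 - l)⁻¹ • y‖⁻¹ • (1 - l)⁻¹ • y = ‖y‖⁻¹ • y := by
      rw [norm_smul, Real.norm_eq_abs, abs_of_pos (inv_pos.2 hp), mul_inv, smul_smul]
      congr 1
      field_simp
    show ‖(1 - l)⁻¹ • y‖⁻¹ • (1 - l)⁻¹ • y ∈ _
    rw [this]; exact hy.1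
  · rw [norm_smul, Real.norm_eq_abs, abs_of_pos (inv_pos.2 hp), inv_mul_lt_iff₀ hp]
    linarith
  · show (1 - l) • (1 - l)⁻¹ • y = y
    rw [smul_smul, mul_inv_cancel₀ hp.ne', one_smul]

lemma nrm_dist (y : E) (hy : y ≠ 0) (h1 : ‖y‖ ≤ 1) : ‖‖y‖⁻¹ • y - y‖ = 1 - ‖y‖ := by
  have hp : 0 < ‖y‖ := norm_pos_iff.2 hy
  have : ‖y‖⁻¹ • y - y = (‖y‖⁻¹ - 1) • y := by module
  rw [this, norm_smul, Real.norm_eq_abs, abs_of_nonneg (by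
    rw [sub_nonneg]; exact (one_le_inv₀ hp).2 h1)]
  field_simp

lemma cap_upper1 [Nontrivial E] (x : E) {l : ℝ} (h0 : 0 < l) (h1 : l < 1) :
    volume.real (cone x l) ≤ 2 ^ finrank ℝ E * volume.real (ball (0:E) 1) * l ^ (finrank ℝ E - 1) := by
  have hD : 0 < finrank ℝ E := finrank_pos
  obtain ⟨m, hm⟩ : ∃ m, finrank ℝ E = m + 1 := ⟨finrank ℝ E - 1, by omega⟩
  have ha := cone_annulus x h0 h1
  have hb : volume.real (cone x l \ (1 - l) • cone x l) ≤ volume.real (closedBall x (2 * l)) := by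
    apply measureReal_mono _ measure_closedBall_lt_top.ne
    rintro y ⟨hy, hy'⟩
    have hn := not_mem_smul_cone h1 hy' hy
    have hy0 : y ≠ 0 := by rintro rfl; simp at hn; linarith
    have h3 := nrm_dist y hy0 hy.2.le
    have h4 : ‖‖y‖⁻¹ • y - x‖ ≤ l := by simpa [dist_eq_norm] using hy.1
    rw [mem_closedBall, dist_eq_norm]
    calc ‖y - x‖ = ‖(‖y‖⁻¹ • y - x) - (‖y‖⁻¹ • y - y)‖ := by congr 1; abel
      _ ≤ ‖‖y‖⁻¹ • y - x‖ + ‖‖y‖⁻¹ • y - y‖ := norm_sub_le _ _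
      _ ≤ 2 * l := by linarith
  rw [vball x (by linarith), ha] at hb
  have hc : l ≤ 1 - (1 - l) ^ finrank ℝ E := by
    have : (1 - l) ^ finrank ℝ E ≤ (1 - l) ^ 1 :=
      pow_le_pow_of_le_one (by linarith) (by linarith) hD
    linarith [pow_one (1 - l)]
  have h5 : l * volume.real (cone x l) ≤ (2 * l) ^ finrank ℝ E * volume.real (ball (0:E) 1) :=
    (mul_le_mul_of_nonneg_right hc measureReal_nonneg).trans hb
  rw [hm] at h5 ⊢
  simp only [Nat.add_sub_cancel]
  have h6 : (2 * l) ^ (m + 1) * volume.real (ball (0:E) 1) =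
    l * (2 ^ (m + 1) * volume.real (ball (0:E) 1) * l ^ m) := by ring
  rw [h6] at h5
  exact le_of_mul_le_mul_left h5 h0

lemma cap_lower1 [Nontrivial E] (x : E) (hx : ‖x‖ = 1) {l : ℝ} (h0 : 0 < l) (h1 : l < 1) :
    volume.real (ball (0:E) 1) / (5 ^ finrank ℝ E * finrank ℝ E) * l ^ (finrank ℝ E - 1) ≤
    volume.real (cone x l) := by
  have hD : 0 < finrank ℝ E := finrank_pos
  obtain ⟨m, hm⟩ : ∃ m, finrank ℝ E = m + 1 := ⟨finrank ℝ E - 1, by omega⟩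
  have ha := cone_annulus x h0 h1
  have hb : volume.real (closedBall ((1 - 3 * l / 10) • x) (l / 5)) ≤
      volume.real (cone x l \ (1 - l) • cone x l) := by
    apply measureReal_mono _ ((measure_mono Set.sdiff_subset).trans_lt (cone_fin x l).lt_top).ne
    intro y hy
    rw [mem_closedBall, dist_eq_norm] at hy
    have e1 : ‖(1 - 3 * l / 10) • x‖ = 1 - 3 * l / 10 := by
      rw [norm_smul, hx, Real.norm_eq_abs, abs_of_pos (by linarith), mul_one]
    have e2 := norm_sub_norm_le y ((1 - 3 * l / 10) • x)
    have e3 := norm_sub_norm_le ((1 - 3 * l / 10) • x) y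
    rw [norm_sub_rev] at e3
    rw [e1] at e2 e3
    have hyl : ‖y‖ < 1 := by linarith
    have hyg : 1 - l / 2 ≤ ‖y‖ := by linarith
    have hy0 : y ≠ 0 := by rintro rfl; simp at hyg; linarith
    have h3 := nrm_dist y hy0 hyl.le
    have h4 : ‖(1 - 3 * l / 10) • x - x‖ = 3 * l / 10 := by
      have : (1 - 3 * l / 10) • x - x = (-(3 * l / 10)) • x := by module
      rw [this, norm_smul, hx, norm_neg, Real.norm_eq_abs, abs_of_pos (by linarith), mul_one]
    refine ⟨⟨?_, hyl⟩, ?_⟩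
    · rw [mem_closedBall, dist_eq_norm]
      calc ‖‖y‖⁻¹ • y - x‖ = ‖(‖y‖⁻¹ • y - y) + ((y - (1 - 3 * l / 10) • x) +
            ((1 - 3 * l / 10) • x - x))‖ := by congr 1; abel
        _ ≤ _ := norm_add_le _ _
        _ ≤ ‖‖y‖⁻¹ • y - y‖ + (‖y - (1 - 3 * l / 10) • x‖ + ‖(1 - 3 * l / 10) • x - x‖) := by
          gcongr; exact norm_add_le _ _
        _ ≤ l := by linarith
    · rintro ⟨z, hz, rfl⟩
      have : ‖(1 - l) • z‖ < 1 - l := by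
        rw [norm_smul, Real.norm_eq_abs, abs_of_pos (by linarith)]
        have := hz.2
        nlinarith
      simp only [] at hyg
      linarith
  rw [vball _ (by linarith), ha] at hb
  have hc : 1 - (1 - l) ^ finrank ℝ E ≤ finrank ℝ E * l := by
    have := one_add_mul_le_pow (a := -l) (by linarith) (finrank ℝ E)
    have h' : (1 + -l) = 1 - l := by ring
    rw [h'] at this
    linarith
  have h5 := hb.trans (mul_le_mul_of_nonneg_right hc measureReal_nonneg)
  rw [hm] at h5 ⊢
  simp only [Nat.add_sub_cancel]
  rw [div_mul_eq_mul_div, div_le_iff₀ (by positivity)]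
  have h6 : (l / 5) ^ (m + 1) * volume.real (ball (0:E) 1) =
    l * (volume.real (ball (0:E) 1) * l ^ m / 5 ^ (m + 1)) := by
      rw [div_pow]; ring
  rw [h6, mul_assoc, mul_comm ((m + 1 : ℕ) : ℝ), mul_assoc] at h5
  have h7 := le_of_mul_le_mul_left h5 h0
  rw [div_le_iff₀ (by positivity)] at h7
  linarith

lemma sph_caps (E : Type*) [NormedAddCommGroup E] [InnerProductSpace ℝ E] [FiniteDimensional ℝ E]
    [MeasurableSpace E] [BorelSpace E] [Nontrivial E] : ∃ c1 > (0:ℝ), ∃ c2 > (0:ℝ),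
    (∀ x : E, ‖x‖ = 1 → ∀ l : ℝ, 0 < l → l < 1 →
      c1 * l ^ (finrank ℝ E - 1) ≤ (sph E).real (closedBall x l)) ∧
    (∀ x : E, ∀ l : ℝ, 0 < l →
      (sph E).real (closedBall x l) ≤ c2 * l ^ (finrank ℝ E - 1)) := by
  have hv : 0 < volume.real (ball (0:E) 1) :=
    ENNReal.toReal_pos (measure_ball_pos _ _ one_pos).ne' measure_ball_lt_top.ne
  have hD : 0 < finrank ℝ E := finrank_pos
  refine ⟨volume.real (ball (0:E) 1) / (5 ^ finrank ℝ E * finrank ℝ E), ?_, 2 ^ finrank ℝ E * volume.real (ball (0:E) 1), by positivity,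
    fun x hx l h0 h1 => ?_, fun x l h0 => ?_⟩
  rotate_left
  · rw [sph_real_apply measurableSet_closedBall]
    exact cap_lower1 x hx h0 h1
  · rw [sph_real_apply measurableSet_closedBall]
    rcases lt_or_ge l 1 with h1 | h1
    · exact cap_upper1 x h0 h1
    · have h2 : volume.real (cone x l) ≤ volume.real (ball (0:E) 1) := by
        apply measureReal_mono _ measure_ball_lt_top.ne
        intro y hy; simpa using hy.2
      have h3 : (1:ℝ) ≤ 2 ^ finrank ℝ E := one_le_pow₀ (by norm_num)
      have h4 : (1:ℝ) ≤ l ^ (finrank ℝ E - 1) := one_le_pow₀ h1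
      refine h2.trans ?_
      have h5 : (1:ℝ) ≤ 2 ^ finrank ℝ E * l ^ (finrank ℝ E - 1) := by nlinarith
      nlinarith
  · positivity

end SphMeas


section Kern
set_option linter.unusedSectionVars false
open MeasureTheory Metric Module Polynomial

/-- Dirichlet kernel as a polynomial. -/
noncomputable def Dk (n : ℕ) : ℝ[X] :=
  1 + 2 * ∑ j ∈ Finset.range n, Chebyshev.T ℝ ((j : ℤ) + 1)

lemma Dk_deg (n : ℕ) : (Dk n).natDegree ≤ n := by
  unfold Dk
  refine (natDegree_add_le _ _).trans (max_le (by simp) ?_)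
  have h2 : (2 : ℝ[X]) = C 2 := rfl
  rw [h2]
  refine (natDegree_C_mul_le _ _).trans ?_
  apply natDegree_sum_le_of_forall_le
  intro j hj
  rw [Finset.mem_range] at hj
  have := Chebyshev.natDegree_T ℝ ((j : ℤ) + 1)
  rw [this]
  omega

lemma Dk_cos (n : ℕ) (t : ℝ) :
    (Dk n).eval (Real.cos t) = 1 + 2 * ∑ j ∈ Finset.range n, Real.cos ((j + 1) * t) := by
  simp [Dk, eval_finsetSum, Chebyshev.T_real_cos]

lemma Dk_abs (n : ℕ) (t : ℝ) : |(Dk n).eval (Real.cos t)| ≤ 2 * n + 1 := by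
  rw [Dk_cos]
  have h : |∑ j ∈ Finset.range n, Real.cos ((j + 1) * t)| ≤ n := by
    refine (Finset.abs_sum_le_sum_abs _ _).trans ?_
    refine (Finset.sum_le_sum (fun j _ => Real.abs_cos_le_one _)).trans ?_
    simp
  rw [abs_le] at h ⊢
  constructor <;> linarith [h.1, h.2]

lemma Dk_sin (n : ℕ) (t : ℝ) :
    (Dk n).eval (Real.cos t) * Real.sin (t / 2) = Real.sin ((n + 1 / 2) * t) := by
  rw [Dk_cos]
  induction n with
  | zero => simp; congr 1; ring
  | succ n ih =>
    rw [Finset.sum_range_succ]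
    have : (1 + 2 * (∑ j ∈ Finset.range n, Real.cos ((j + 1) * t) + Real.cos ((n + 1) * t))) *
      Real.sin (t / 2) = Real.sin ((n + 1 / 2) * t) +
        2 * (Real.cos ((n + 1) * t) * Real.sin (t / 2)) := by rw [← ih]; ring
    rw [this]
    have e1 : ((n:ℝ) + 1 / 2) * t = (n + 1) * t - t / 2 := by ring
    have e2 : (((n + 1 : ℕ):ℝ) + 1 / 2) * t = (n + 1) * t + t / 2 := by push_cast; ring
    rw [e1, e2, Real.sin_sub, Real.sin_add]
    ring

lemma Dk_low (n : ℕ) (t : ℝ) (h0 : 0 ≤ t) (h : n * t ≤ 1) :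
    n ≤ (Dk n).eval (Real.cos t) := by
  rw [Dk_cos]
  have : ∑ j ∈ Finset.range n, (1/2:ℝ) ≤ ∑ j ∈ Finset.range n, Real.cos ((j + 1) * t) := by
    apply Finset.sum_le_sum
    intro j hj
    rw [Finset.mem_range] at hj
    have hj' : (j:ℝ) + 1 ≤ n := by exact_mod_cast hj
    have h1 : ((j:ℝ) + 1) * t ≤ 1 := (mul_le_mul_of_nonneg_right hj' h0).trans h
    have h2 : 0 ≤ ((j:ℝ) + 1) * t := by positivity
    have := Real.one_sub_sq_div_two_le_cos (x := ((j:ℝ) + 1) * t)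
    nlinarith
  simp at this
  linarith

variable {E : Type*} [NormedAddCommGroup E] [InnerProductSpace ℝ E]

lemma exists_angle {x y : E} (hx : ‖x‖ = 1) (hy : ‖y‖ = 1) :
    ∃ t : ℝ, 0 ≤ t ∧ t ≤ Real.pi ∧ Real.cos t = inner ℝ x y ∧ ‖x - y‖ = 2 * Real.sin (t / 2) := by
  have habs := abs_real_inner_le_norm x y
  rw [hx, hy, mul_one, abs_le] at habs
  have hc := Real.cos_arccos habs.1 habs.2
  refine ⟨Real.arccos (inner ℝ x y), Real.arccos_nonneg _, Real.arccos_le_pi _, hc, ?_⟩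
  have h0 := Real.arccos_nonneg (inner ℝ x y)
  have h1 := Real.arccos_le_pi (inner ℝ x y)
  have hs : 0 ≤ Real.sin (Real.arccos (inner ℝ x y) / 2) :=
    Real.sin_nonneg_of_nonneg_of_le_pi (by linarith) (by linarith [Real.pi_pos])
  rw [← sq_eq_sq₀ (norm_nonneg _) (by positivity), norm_sub_sq_real, hx, hy, mul_pow,
    Real.sin_sq_eq_half_sub]
  have : 2 * (Real.arccos (inner ℝ x y) / 2) = Real.arccos (inner ℝ x y) := by ring
  rw [this, hc]
  ring

lemma Dk_abs' (n : ℕ) {x y : E} (hx : ‖x‖ = 1) (hy : ‖y‖ = 1) :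
    |(Dk n).eval (inner ℝ x y)| ≤ 2 * n + 1 := by
  obtain ⟨t, _, _, hc, _⟩ := exists_angle hx hy
  rw [← hc]; exact Dk_abs n t

lemma Dk_mul' (n : ℕ) {x y : E} (hx : ‖x‖ = 1) (hy : ‖y‖ = 1) :
    |(Dk n).eval (inner ℝ x y)| * ‖x - y‖ ≤ 2 := by
  obtain ⟨t, h0, h1, hc, hd⟩ := exists_angle hx hy
  have hs : 0 ≤ Real.sin (t / 2) :=
    Real.sin_nonneg_of_nonneg_of_le_pi (by linarith) (by linarith [Real.pi_pos])
  rw [← hc, hd]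
  have := Dk_sin n t
  have h2 : |(Dk n).eval (Real.cos t)| * Real.sin (t / 2) ≤ 1 := by
    rw [← abs_of_nonneg hs, ← abs_mul, this]; exact Real.abs_sin_le_one _
  linarith

lemma Dk_low' (n : ℕ) {x y : E} (hx : ‖x‖ = 1) (hy : ‖y‖ = 1) (h : n * ‖x - y‖ ≤ 1 / 2) :
    n ≤ (Dk n).eval (inner ℝ x y) := by
  obtain ⟨t, h0, h1, hc, hd⟩ := exists_angle hx hy
  rw [← hc]
  apply Dk_low n t h0
  have h2 := Real.mul_le_sin (x := t / 2) (by linarith) (by linarith)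
  have hpi := Real.pi_le_four
  have hp := Real.pi_pos
  have h3 : t ≤ 2 * (2 * Real.sin (t / 2)) := by
    have : t / 2 ≤ Real.pi / 2 * Real.sin (t / 2) := by
      calc t / 2 = Real.pi / 2 * (2 / Real.pi * (t / 2)) := by field_simp
        _ ≤ _ := by gcongr
    have hs : 0 ≤ Real.sin (t / 2) :=
      Real.sin_nonneg_of_nonneg_of_le_pi (by linarith) (by linarith [Real.pi_pos])
    nlinarith
  rw [← hd] at h3
  have hn : (0:ℝ) ≤ n := by positivity
  nlinarith

lemma kern_point (n p : ℕ) (hn : 1 ≤ n) (hp : 1 ≤ p) {x y : E} (hx : ‖x‖ = 1) (hy : ‖y‖ = 1) :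
    n * (‖x - y‖ * |(Dk n).eval (inner ℝ x y)| ^ p) ≤
      ∑ i ∈ Finset.range (2 * n + 1), n ^ p * 4 ^ p / ((i:ℝ) + 1) ^ (p - 1) *
        (closedBall x (((i:ℝ) + 1) / n)).indicator (fun _ => (1:ℝ)) y := by
  obtain ⟨q, rfl⟩ : ∃ q, p = q + 1 := ⟨p - 1, by omega⟩
  simp only [Nat.add_sub_cancel]
  set r := ‖x - y‖ with hr
  set k := |(Dk n).eval (inner ℝ x y)| with hk
  have hn0 : (0:ℝ) < n := by exact_mod_cast hn
  have hr0 : 0 ≤ r := norm_nonneg _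
  have hk0 : 0 ≤ k := abs_nonneg _
  have hr2 : r ≤ 2 := by
    have := norm_sub_le x y
    rw [hx, hy] at this; linarith
  have k1 : k ≤ 2 * n + 1 := Dk_abs' n hx hy
  have k2 : k * r ≤ 2 := Dk_mul' n hx hy
  set i := ⌊n * r⌋₊ with hi
  have i1 : (i:ℝ) ≤ n * r := Nat.floor_le (by positivity)
  have i2 : n * r < i + 1 := Nat.lt_floor_add_one _
  have i3 : i ∈ Finset.range (2 * n + 1) := by
    rw [Finset.mem_range]
    have : (i:ℝ) < 2 * n + 1 := by nlinarith
    exact_mod_cast this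
  have hmem : y ∈ closedBall x (((i:ℝ) + 1) / n) := by
    rw [mem_closedBall, dist_eq_norm, norm_sub_rev, ← hr, le_div_iff₀ hn0]
    linarith
  refine le_trans ?_ (Finset.single_le_sum (f := fun i : ℕ => (n:ℝ) ^ (q + 1) * 4 ^ (q + 1) /
    ((i:ℝ) + 1) ^ q * (closedBall x (((i:ℝ) + 1) / n)).indicator (fun _ => (1:ℝ)) y) ?_ i3)
  · simp only [Set.indicator_of_mem hmem, mul_one]
    rw [le_div_iff₀ (by positivity)]
    rcases Nat.eq_zero_or_pos i with h0 | h0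
    · rw [h0] at i2 ⊢
      simp only [Nat.cast_zero, zero_add, one_pow, mul_one] at i2 ⊢
      have : k ≤ n * 4 := by
        have : (1:ℝ) ≤ n := by exact_mod_cast hn
        linarith
      rw [← mul_pow, ← mul_assoc]
      calc n * r * k ^ (q + 1) ≤ 1 * k ^ (q + 1) := by gcongr
        _ ≤ _ := by rw [one_mul]; gcongr
    · have hi1 : (1:ℝ) ≤ i := by exact_mod_cast h0
      have h5 : ((i:ℝ) + 1) ^ q ≤ (2 * (n * r)) ^ q := by
        gcongr; linarith
      calc n * (r * k ^ (q + 1)) * ((i:ℝ) + 1) ^ q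
          ≤ n * (r * k ^ (q + 1)) * (2 * (n * r)) ^ q := by gcongr
        _ = n ^ (q + 1) * 2 ^ q * (k * r) ^ (q + 1) := by ring
        _ ≤ n ^ (q + 1) * 2 ^ q * 2 ^ (q + 1) := by gcongr
        _ ≤ n ^ (q + 1) * 2 ^ (q + 1) * 2 ^ (q + 1) := by
          gcongr <;> norm_num
        _ = n ^ (q + 1) * 4 ^ (q + 1) := by rw [mul_assoc, ← mul_pow]; norm_num
  · intro j _
    have : 0 ≤ (closedBall x (((j:ℝ) + 1) / n)).indicator (fun _ => (1:ℝ)) y :=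
      Set.indicator_nonneg (fun _ _ => zero_le_one) _
    positivity

variable [FiniteDimensional ℝ E] [MeasurableSpace E] [BorelSpace E] [Nontrivial E]

lemma sph_integrable {g : E → ℝ} (hg : ContinuousOn g (sphere 0 1)) : Integrable g (sph E) := by
  have h1 : (sph E).restrict (sphere 0 1) = sph E := by
    apply Measure.restrict_eq_self_of_ae_mem
    filter_upwards [sph_sphere (E := E)] with y hy
    simpa using hy
  have := hg.integrableOn_compact (μ := sph E) (isCompact_sphere 0 1)
  rwa [IntegrableOn, h1] at this

/-- Exponent of the Jackson kernel. -/
noncomputable def pE (E : Type*) [NormedAddCommGroup E] [InnerProductSpace ℝ E] : ℕ :=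
  2 * (finrank ℝ E + 1)

/-- Jackson kernel. -/
noncomputable def Kn (E : Type*) [NormedAddCommGroup E] [InnerProductSpace ℝ E] (n : ℕ) : ℝ[X] :=
  (Dk n) ^ (pE E)

lemma Kn_nonneg (n : ℕ) (t : ℝ) : 0 ≤ (Kn E n).eval t := by
  unfold Kn pE; rw [eval_pow]; exact Even.pow_nonneg (even_two_mul _) _

lemma Kn_abs (n : ℕ) (t : ℝ) : (Kn E n).eval t = |(Dk n).eval t| ^ pE E := by
  unfold Kn pE; rw [eval_pow, Even.pow_abs (even_two_mul _)]

lemma Kn_cont (n : ℕ) (x : E) : Continuous fun y => (Kn E n).eval (inner ℝ x y) := by fun_prop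

lemma kern_moment (E : Type*) [NormedAddCommGroup E] [InnerProductSpace ℝ E] [FiniteDimensional ℝ E]
    [MeasurableSpace E] [BorelSpace E] [Nontrivial E] :
    ∃ C > (0:ℝ), ∀ n : ℕ, 1 ≤ n → ∀ x : E, ‖x‖ = 1 →
      0 < ∫ y, (Kn E n).eval (inner ℝ x y) ∂(sph E) ∧
      ∫ y, (Kn E n).eval (inner ℝ x y) * ‖x - y‖ ∂(sph E) ≤
        C / n * ∫ y, (Kn E n).eval (inner ℝ x y) ∂(sph E) := by
  obtain ⟨c1, hc1, c2, hc2, hlo, hup⟩ := sph_caps E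
  have hD : 0 < finrank ℝ E := finrank_pos
  set m := finrank ℝ E - 1 with hm
  have hsum : Summable fun i : ℕ => 1 / ((i:ℝ) + 1) ^ 2 := by
    have := (summable_nat_add_iff 1).2 (Real.summable_one_div_nat_pow.2 (by norm_num : 1 < 2))
    simpa using this
  set S := ∑' i : ℕ, 1 / ((i:ℝ) + 1) ^ 2 with hS
  have hS0 : 0 < S := hsum.tsum_pos (fun i => by positivity) 0 (by norm_num)
  have hpE : pE E = 2 * m + 4 := by unfold pE; omega
  refine ⟨4 ^ pE E * c2 * S * 2 ^ m / c1, by positivity, fun n hn x hx => ?_⟩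
  have hn0 : (0:ℝ) < n := by exact_mod_cast hn
  have hn1 : (1:ℝ) ≤ n := by exact_mod_cast hn
  have hZ : c1 * n ^ (m + 4) / 2 ^ m ≤ ∫ y, (Kn E n).eval (inner ℝ x y) ∂(sph E) := by
    have h1 : ∫ y, (closedBall x (1 / (2 * n))).indicator (fun _ => (n:ℝ) ^ pE E) y ∂(sph E) ≤
        ∫ y, (Kn E n).eval (inner ℝ x y) ∂(sph E) := by
      apply integral_mono_ae
      · exact (integrable_const _).indicator measurableSet_closedBall
      · exact sph_integrable (Kn_cont n x).continuousOn
      · filter_upwards [sph_sphere (E := E)] with y hy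
        by_cases hyb : y ∈ closedBall x (1 / (2 * n))
        · rw [Set.indicator_of_mem hyb, Kn_abs]
          gcongr
          rw [mem_closedBall, dist_eq_norm, norm_sub_rev, le_div_iff₀ (by positivity)] at hyb
          exact (Dk_low' n hx hy (by linarith)).trans (le_abs_self _)
        · rw [Set.indicator_of_notMem hyb]; exact Kn_nonneg _ _
    refine le_trans ?_ h1
    rw [integral_indicator_const _ measurableSet_closedBall, smul_eq_mul]
    have h2 := hlo x hx (1 / (2 * n)) (by positivity) (by
      rw [div_lt_one (by positivity)]; linarith)
    refine le_trans (le_of_eq ?_) (mul_le_mul_of_nonneg_right h2 (by positivity))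
    have hpp : (n:ℝ) ^ pE E = n ^ (m + 4) * n ^ m := by rw [hpE, ← pow_add]; congr 1; omega
    rw [hpp, div_pow, mul_pow, one_pow]
    field_simp
  have hZ0 : 0 < ∫ y, (Kn E n).eval (inner ℝ x y) ∂(sph E) :=
    lt_of_lt_of_le (by positivity) hZ
  refine ⟨hZ0, ?_⟩
  have hU : n * ∫ y, (Kn E n).eval (inner ℝ x y) * ‖x - y‖ ∂(sph E) ≤
      4 ^ pE E * c2 * S * n ^ (m + 4) := by
    rw [← integral_const_mul]
    have h1 : ∫ y, n * ((Kn E n).eval (inner ℝ x y) * ‖x - y‖) ∂(sph E) ≤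
        ∫ y, ∑ i ∈ Finset.range (2 * n + 1), n ^ pE E * 4 ^ pE E / ((i:ℝ) + 1) ^ (pE E - 1) *
        (closedBall x (((i:ℝ) + 1) / n)).indicator (fun _ => (1:ℝ)) y ∂(sph E) := by
      apply integral_mono_ae
      · apply sph_integrable
        have := Kn_cont n x
        fun_prop
      · apply integrable_finsetSum
        intro i _
        exact ((integrable_const _).indicator measurableSet_closedBall).const_mul _
      · filter_upwards [sph_sphere (E := E)] with y hy
        have := kern_point n (pE E) hn (by omega) hx hy
        rw [Kn_abs, mul_comm (_ ^ _)]
        exact this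
    refine h1.trans ?_
    rw [integral_finsetSum _ (fun i _ =>
      ((integrable_const _).indicator measurableSet_closedBall).const_mul _)]
    have h2 : ∀ i ∈ Finset.range (2 * n + 1),
        ∫ y, n ^ pE E * 4 ^ pE E / ((i:ℝ) + 1) ^ (pE E - 1) *
        (closedBall x (((i:ℝ) + 1) / n)).indicator (fun _ => (1:ℝ)) y ∂(sph E) ≤
        4 ^ pE E * c2 * n ^ (m + 4) * (1 / ((i:ℝ) + 1) ^ 2) := by
      intro i _
      rw [integral_const_mul, integral_indicator_const _ measurableSet_closedBall, smul_eq_mul,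
        mul_one]
      have h3 := hup x (((i:ℝ) + 1) / n) (by positivity)
      refine (mul_le_mul_of_nonneg_left h3 (by positivity)).trans ?_
      have h4 : ((i:ℝ) + 1) ^ (m + 2) ≤ ((i:ℝ) + 1) ^ (pE E - 1) :=
        pow_le_pow_right₀ (by linarith [(Nat.cast_nonneg i : (0:ℝ) ≤ i)]) (by omega)
      calc (n:ℝ) ^ pE E * 4 ^ pE E / ((i:ℝ) + 1) ^ (pE E - 1) * (c2 * (((i:ℝ) + 1) / n) ^ m)
          ≤ (n:ℝ) ^ pE E * 4 ^ pE E / ((i:ℝ) + 1) ^ (m + 2) * (c2 * (((i:ℝ) + 1) / n) ^ m) := by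
            gcongr
        _ = _ := by
          have : (n:ℝ) ^ pE E = n ^ (m + 4) * n ^ m := by rw [hpE, ← pow_add]; congr 1; omega
          rw [this, div_pow, pow_add _ m 2]
          field_simp
    refine (Finset.sum_le_sum h2).trans ?_
    rw [← Finset.mul_sum]
    have h5 : ∑ i ∈ Finset.range (2 * n + 1), 1 / ((i:ℝ) + 1) ^ 2 ≤ S :=
      hsum.sum_le_tsum _ (fun i _ => by positivity)
    calc _ ≤ 4 ^ pE E * c2 * n ^ (m + 4) * S := by gcongr
      _ = _ := by ring
  have h6 : 4 ^ pE E * c2 * S * n ^ (m + 4) ≤ (4 ^ pE E * c2 * S * 2 ^ m / c1) *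
      ∫ y, (Kn E n).eval (inner ℝ x y) ∂(sph E) := by
    refine le_trans (le_of_eq ?_) (mul_le_mul_of_nonneg_left hZ (by positivity))
    field_simp
  rw [div_mul_eq_mul_div, le_div_iff₀ hn0]
  linarith

end Kern


section Oper
set_option linter.unusedSectionVars false
open MeasureTheory Metric Module Polynomial

variable {E : Type*} [NormedAddCommGroup E] [InnerProductSpace ℝ E]

lemma exists_rot {x y : E} (hx : ‖x‖ = 1) (hy : ‖y‖ = 1) (hxy : ‖x - y‖ ≤ 1) :
    ∃ R : E ≃ₗᵢ[ℝ] E, R x = y ∧ nd R ≤ 4 * ‖x - y‖ := by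
  have hsq : ‖x + y‖ ^ 2 = 4 - ‖x - y‖ ^ 2 := by
    have := parallelogram_law_with_norm ℝ x y
    rw [hx, hy] at this
    nlinarith
  have hq3 : 3 ≤ ‖x + y‖ ^ 2 := by rw [hsq]; nlinarith [norm_nonneg (x - y)]
  have hq0 : 0 < ‖x + y‖ ^ 2 := by linarith
  have h1 : ∀ w, (ℝ ∙ x).reflection w = (2 * inner ℝ x w) • x - w := by
    intro w
    rw [Submodule.reflection_singleton_apply, hx]
    simp [two_smul, two_mul, add_smul]
  have h2 : ∀ w, (ℝ ∙ (x + y)).reflection w =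
      (2 * (inner ℝ (x + y) w / ‖x + y‖ ^ 2)) • (x + y) - w := by
    intro w
    rw [Submodule.reflection_singleton_apply]
    simp [two_smul, two_mul, add_smul]
  refine ⟨(ℝ ∙ x).reflection.trans (ℝ ∙ (x + y)).reflection, ?_, ?_⟩
  · rw [LinearIsometryEquiv.trans_apply, h1 x, real_inner_self_eq_norm_sq, hx]
    have : ((2:ℝ) * 1 ^ 2) • x - x = x := by module
    rw [this, h2, inner_add_left, real_inner_self_eq_norm_sq, hx]
    have h3 : ‖x + y‖ ^ 2 = 2 * (1 ^ 2 + inner ℝ y x) := by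
      rw [norm_add_sq_real, hx, hy, real_inner_comm]; ring
    have : 2 * ((1 ^ 2 + inner ℝ y x) / ‖x + y‖ ^ 2) = 1 := by
      rw [mul_div_assoc', ← h3, div_self hq0.ne']
    rw [this]; module
  · apply nd_le_of _ _ (by positivity)
    intro v
    rw [LinearIsometryEquiv.trans_apply]
    set w := (ℝ ∙ x).reflection v with hw
    have hv : v = (ℝ ∙ x).reflection w := by rw [hw, Submodule.reflection_reflection]
    have hnw : ‖w‖ = ‖v‖ := by rw [hw, LinearIsometryEquiv.norm_map]
    rw [← hnw, hv, h1, h2]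
    set δ := y - x with hδ
    have hδn : ‖x - y‖ = ‖δ‖ := norm_sub_rev _ _
    rw [hδn] at hsq hxy ⊢
    have hs : x + y = (2:ℝ) • x + δ := by rw [hδ]; module
    have e : (2 * (inner ℝ (x + y) w / ‖x + y‖ ^ 2)) • (x + y) - w - ((2 * inner ℝ x w) • x - w) =
        (2 / ‖x + y‖ ^ 2) • ((‖δ‖ ^ 2 * inner ℝ x w + 2 * inner ℝ δ w) • x +
          (2 * inner ℝ x w + inner ℝ δ w) • δ) := by
      have hq : ‖δ‖ ^ 2 = 4 - ‖x + y‖ ^ 2 := by linarith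
      rw [hq]
      have i1 : inner ℝ (x + y) w = 2 * inner ℝ x w + inner ℝ δ w := by
        rw [hs, inner_add_left, real_inner_smul_left]
      rw [i1]
      have hne : ‖x + y‖ ^ 2 ≠ 0 := hq0.ne'
      generalize ‖x + y‖ ^ 2 = q at hne ⊢
      rw [hs]
      match_scalars <;> field_simp <;> ring
    rw [e, norm_smul]
    have j1 : |inner ℝ x w| ≤ ‖w‖ := by simpa [hx] using abs_real_inner_le_norm x w
    have j2 : |inner ℝ δ w| ≤ ‖δ‖ * ‖w‖ := abs_real_inner_le_norm δ w
    have hd0 := norm_nonneg δ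
    have hw0 := norm_nonneg w
    have j3 : ‖(‖δ‖ ^ 2 * inner ℝ x w + 2 * inner ℝ δ w) • x +
          (2 * inner ℝ x w + inner ℝ δ w) • δ‖ ≤ 6 * (‖δ‖ * ‖w‖) := by
      refine (norm_add_le _ _).trans ?_
      rw [norm_smul, norm_smul, hx, Real.norm_eq_abs, Real.norm_eq_abs, mul_one]
      have k1 : |‖δ‖ ^ 2 * inner ℝ x w + 2 * inner ℝ δ w| ≤ 3 * (‖δ‖ * ‖w‖) := by
        refine (abs_add_le _ _).trans ?_
        rw [abs_mul, abs_mul, abs_of_nonneg (sq_nonneg ‖δ‖), abs_two]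
        have : ‖δ‖ ^ 2 * |inner ℝ x w| ≤ ‖δ‖ * ‖w‖ := by
          have : ‖δ‖ ^ 2 ≤ ‖δ‖ := by nlinarith
          gcongr
        linarith
      have k2 : |2 * inner ℝ x w + inner ℝ δ w| ≤ 3 * ‖w‖ := by
        refine (abs_add_le _ _).trans ?_
        rw [abs_mul, abs_two]
        nlinarith
      nlinarith
    have j4 : ‖2 / ‖x + y‖ ^ 2‖ ≤ 2 / 3 := by
      rw [Real.norm_eq_abs, abs_of_pos (by positivity)]
      gcongr
    calc _ ≤ 2 / 3 * (6 * (‖δ‖ * ‖w‖)) := by gcongr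
      _ = _ := by ring

lemma Wc.lip {M : ℝ} {F : E → ℝ} (h : Wc 1 M F) {x y : E} (hx : ‖x‖ = 1) (hy : ‖y‖ = 1) :
    |F x - F y| ≤ 4 * M * ‖x - y‖ := by
  have hM : 0 ≤ M := (abs_nonneg _).trans (h.1 x hx)
  rcases le_total ‖x - y‖ 1 with h1 | h1
  · obtain ⟨R, hR, hn⟩ := exists_rot hx hy h1
    have := h.2 R x hx
    simp only [hR] at this
    rw [abs_sub_comm]
    refine this.trans ?_
    nlinarith
  · have a := h.1 x hx
    have b := h.1 y hy
    have := abs_sub (F x) (F y)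
    nlinarith

variable [FiniteDimensional ℝ E] [MeasurableSpace E] [BorelSpace E] [Nontrivial E]

/-- Unnormalized convolution with the kernel. -/
noncomputable def Qop (n : ℕ) (F : E → ℝ) (x : E) : ℝ :=
  ∫ y, (Kn E n).eval (inner ℝ x y) * F y ∂(sph E)

/-- Normalizing factor. -/
noncomputable def Zn (n : ℕ) (x : E) : ℝ := ∫ y, (Kn E n).eval (inner ℝ x y) ∂(sph E)

/-- The error operator. -/
noncomputable def Terr (n : ℕ) (F : E → ℝ) (x : E) : ℝ := F x - Qop n F x / Zn n x

lemma sph_comp (R : E ≃ₗᵢ[ℝ] E) (g : E → ℝ) : ∫ y, g (R y) ∂(sph E) = ∫ y, g y ∂(sph E) :=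
  (sph_inv R).integral_comp R.toHomeomorph.measurableEmbedding g

lemma Qop_rot (n : ℕ) (F : E → ℝ) (R : E ≃ₗᵢ[ℝ] E) (x : E) :
    Qop n F (R x) = Qop n (fun y => F (R y)) x := by
  unfold Qop
  rw [← sph_comp R]
  simp only [LinearIsometryEquiv.inner_map_map]

lemma Zn_rot (n : ℕ) (R : E ≃ₗᵢ[ℝ] E) (x : E) : Zn n (R x) = Zn n x := by
  unfold Zn
  rw [← sph_comp R]
  simp only [LinearIsometryEquiv.inner_map_map]

lemma Zn_const (n : ℕ) {x y : E} (hx : ‖x‖ = 1) (hy : ‖y‖ = 1) : Zn n x = Zn n y := by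
  have := Submodule.reflection_sub (v := x) (w := y) (by rw [hx, hy])
  rw [← this, Zn_rot]

lemma KF_int (n : ℕ) {F : E → ℝ} (hF : ContinuousOn F (sphere 0 1)) (x : E) :
    Integrable (fun y => (Kn E n).eval (inner ℝ x y) * F y) (sph E) :=
  sph_integrable ((Kn_cont n x).continuousOn.mul hF)

lemma rot_cont {F : E → ℝ} (hF : ContinuousOn F (sphere 0 1)) (R : E ≃ₗᵢ[ℝ] E) :
    ContinuousOn (fun y => F (R y)) (sphere 0 1) :=
  hF.comp R.continuous.continuousOn (fun y hy => by simpa using hy)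

lemma Terr_rot (n : ℕ) {F : E → ℝ} (hF : ContinuousOn F (sphere 0 1)) (R : E ≃ₗᵢ[ℝ] E) (x : E) :
    Terr n (fun y => F (R y) - F y) x = Terr n F (R x) - Terr n F x := by
  unfold Terr
  have : Qop n (fun y => F (R y) - F y) x = Qop n F (R x) - Qop n F x := by
    rw [Qop_rot]
    unfold Qop
    rw [← integral_sub (KF_int n (rot_cont hF R) x) (KF_int n hF x)]
    simp only [mul_sub]
  rw [this, Zn_rot]
  ring

lemma Qop_cont (n : ℕ) {F : E → ℝ} (hF : ContinuousOn F (sphere 0 1)) :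
    ContinuousOn (Qop n F) (sphere 0 1) := by
  unfold Qop
  refine continuousOn_of_dominated (bound := fun y => ((2 * (n:ℝ) + 1) ^ pE E) * |F y|) ?_ ?_ ?_ ?_
  · intro x _; exact (KF_int n hF x).aestronglyMeasurable
  · intro x hx
    have hx' : ‖x‖ = 1 := by simpa using hx
    filter_upwards [sph_sphere (E := E)] with y hy
    rw [norm_mul, Real.norm_eq_abs, Real.norm_eq_abs, Kn_abs, abs_pow, abs_abs]
    gcongr
    exact Dk_abs' n hx' hy
  · exact (sph_integrable hF).abs.const_mul _
  · refine Filter.Eventually.of_forall fun y => ?_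
    fun_prop

lemma Terr_cont (n : ℕ) {F : E → ℝ} (hF : ContinuousOn F (sphere 0 1)) :
    ContinuousOn (Terr n F) (sphere 0 1) := by
  obtain ⟨x0, hx0⟩ : ∃ x : E, ‖x‖ = 1 := exists_norm_eq E zero_le_one
  have : ContinuousOn (fun x => F x - Qop n F x / Zn n x0) (sphere 0 1) :=
    hF.sub ((Qop_cont n hF).div_const _)
  refine this.congr fun x hx => ?_
  unfold Terr
  rw [Zn_const n (by simpa using hx) hx0]

lemma Terr_step (E : Type*) [NormedAddCommGroup E] [InnerProductSpace ℝ E] [FiniteDimensional ℝ E]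
    [MeasurableSpace E] [BorelSpace E] [Nontrivial E] :
    ∃ C > (0:ℝ), ∀ n : ℕ, 1 ≤ n → ∀ s : ℕ, ∀ (M : ℝ) (F : E → ℝ), 
      ContinuousOn F (sphere 0 1) → Wc (s + 1) M F → Wc s (C / n * M) (Terr n F) := by
  obtain ⟨C, hC, hk⟩ := kern_moment E
  refine ⟨4 * C, by positivity, fun n hn => ?_⟩
  have base : ∀ (M : ℝ) (F : E → ℝ), ContinuousOn F (sphere 0 1) → Wc 1 M F →
      ∀ x, ‖x‖ = 1 → |Terr n F x| ≤ 4 * C / n * M := by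
    intro M F hF hW x hx
    have hM : 0 ≤ M := (abs_nonneg _).trans (hW.1 x hx)
    obtain ⟨hZ, hm⟩ := hk n hn x hx
    have e : Terr n F x = (∫ y, (Kn E n).eval (inner ℝ x y) * (F x - F y) ∂(sph E)) / Zn n x := by
      have h1 : ∫ y, (Kn E n).eval (inner ℝ x y) * (F x - F y) ∂(sph E) =
          Zn n x * F x - Qop n F x := by
        unfold Zn Qop
        rw [← integral_mul_const, ← integral_sub _ (KF_int n hF x)]
        · simp only [mul_sub]
        · exact (sph_integrable (Kn_cont n x).continuousOn).mul_const _
      rw [h1]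
      unfold Terr
      rw [sub_div, mul_div_cancel_left₀ _ (show Zn n x ≠ 0 from hZ.ne')]
    rw [e, abs_div, abs_of_pos (show 0 < Zn n x from hZ), div_le_iff₀ (show 0 < Zn n x from hZ)]
    have h2 : |∫ y, (Kn E n).eval (inner ℝ x y) * (F x - F y) ∂(sph E)| ≤
        ∫ y, (4 * M) * ((Kn E n).eval (inner ℝ x y) * ‖x - y‖) ∂(sph E) := by
      rw [← Real.norm_eq_abs]
      apply norm_integral_le_of_norm_le
      · apply Integrable.const_mul
        apply sph_integrable
        have := Kn_cont n x
        fun_prop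
      · filter_upwards [sph_sphere (E := E)] with y hy
        rw [norm_mul, Real.norm_eq_abs, Real.norm_eq_abs, abs_of_nonneg (Kn_nonneg _ _)]
        have := hW.lip hx hy
        calc _ ≤ (Kn E n).eval (inner ℝ x y) * (4 * M * ‖x - y‖) := by
              gcongr; exact Kn_nonneg _ _
          _ = _ := by ring
    refine h2.trans ?_
    rw [integral_const_mul]
    refine (mul_le_mul_of_nonneg_left hm (by positivity)).trans (le_of_eq ?_)
    unfold Zn; ring
  intro s
  induction s with
  | zero => intro M F hF hW; exact base M F hF hW
  | succ s ih =>
    intro M F hF hW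
    refine ⟨base M F hF ⟨hW.1, fun R => (hW.2 R).bound⟩, fun R => ?_⟩
    have := ih (M * nd R) (fun y => F (R y) - F y) ((rot_cont hF R).sub hF) (hW.2 R)
    rw [← mul_assoc] at this
    exact this.congr fun x _ => Terr_rot n hF R x

lemma Terr_iter_cont (n : ℕ) {F : E → ℝ} (hF : ContinuousOn F (sphere 0 1)) (s : ℕ) :
    ContinuousOn ((Terr n)^[s] F) (sphere 0 1) := by
  induction s with
  | zero => exact hF
  | succ s ih => rw [Function.iterate_succ_apply']; exact Terr_cont n ih

lemma Terr_iter (E : Type*) [NormedAddCommGroup E] [InnerProductSpace ℝ E] [FiniteDimensional ℝ E]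
    [MeasurableSpace E] [BorelSpace E] [Nontrivial E] :
    ∃ C > (0:ℝ), ∀ n : ℕ, 1 ≤ n → ∀ s : ℕ, ∀ (M : ℝ) (F : E → ℝ), 
      ContinuousOn F (sphere 0 1) → Wc s M F → ∀ x, ‖x‖ = 1 →
        |(Terr n)^[s] F x| ≤ (C / n) ^ s * M := by
  obtain ⟨C, hC, h⟩ := Terr_step E
  refine ⟨C, hC, fun n hn s => ?_⟩
  induction s with
  | zero => intro M F _ hW x hx; simpa using hW x hx
  | succ s ih =>
    intro M F hF hW x hx
    rw [Function.iterate_succ_apply]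
    have := ih _ _ (Terr_cont n hF) (h n hn s M F hF hW) x hx
    rw [pow_succ, mul_assoc]
    exact this

lemma Terr_telescope (n : ℕ) (F : E → ℝ) (s : ℕ) (x : E) :
    F x - (Terr n)^[s] F x = ∑ i ∈ Finset.range s, Qop n ((Terr n)^[i] F) x / Zn n x := by
  induction s with
  | zero => simp
  | succ s ih =>
    rw [Finset.sum_range_succ, ← ih, Function.iterate_succ_apply']
    simp only [Terr]
    ring

end Oper


section Jackson

open MeasureTheory Metric

/-- Ambient Euclidean space of one more dimension. -/
abbrev Ed (d : ℕ) := EuclideanSpace ℝ (Fin (d + 1))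

/-- Point evaluation of coefficients. -/
noncomputable def evy {d : ℕ} (y : Ed d) : C(Ed d, ℝ) →+* ℝ :=
  (Pi.evalRingHom (fun _ : Ed d => ℝ) y).comp ContinuousMap.coeFnRingHom

/-- Evaluation in both variables. -/
noncomputable def ev2 {d : ℕ} (x : Fin d → ℝ) (y : Ed d) : MvPolynomial (Fin d) C(Ed d, ℝ) →+* ℝ :=
  MvPolynomial.eval₂Hom (evy y) x

/-- Coordinate function. -/
noncomputable def crd {d : ℕ} (i : Fin (d + 1)) : C(Ed d, ℝ) := ⟨fun y => y i, by fun_prop⟩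

lemma evy_crd {d : ℕ} (y : Ed d) (i : Fin (d + 1)) : evy y (crd i) = y i := rfl

/-- Linear part. -/
noncomputable def lina (d : ℕ) : MvPolynomial (Fin d) C(Ed d, ℝ) :=
  ∑ i : Fin d, MvPolynomial.C (crd i.castSucc) * MvPolynomial.X i

/-- Squared last part. -/
noncomputable def sqb (d : ℕ) : MvPolynomial (Fin d) C(Ed d, ℝ) :=
  MvPolynomial.C (crd (Fin.last d) ^ 2) * (1 - ∑ i : Fin d, MvPolynomial.X i ^ 2)

lemma lina_ev {d : ℕ} (x : Fin d → ℝ) (y : Ed d) :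
    ev2 x y (lina d) = ∑ i, x i * y i.castSucc := by
  simp [lina, ev2, evy_crd, mul_comm]

lemma sqb_ev {d : ℕ} (x : Fin d → ℝ) (y : Ed d) :
    ev2 x y (sqb d) = (1 - ∑ i, x i ^ 2) * (y (Fin.last d)) ^ 2 := by
  simp [sqb, ev2, evy_crd, mul_comm]

lemma lina_deg (d : ℕ) : (lina d).totalDegree ≤ 1 := by
  unfold lina
  refine MvPolynomial.totalDegree_finsetSum_le fun i _ => ?_
  refine (MvPolynomial.totalDegree_mul _ _).trans ?_
  simp

lemma sqb_deg (d : ℕ) : (sqb d).totalDegree ≤ 2 := by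
  unfold sqb
  refine (MvPolynomial.totalDegree_mul _ _).trans ?_
  rw [MvPolynomial.totalDegree_C, zero_add]
  refine (MvPolynomial.totalDegree_sub _ _).trans ?_
  refine max_le (by simp) ?_
  refine MvPolynomial.totalDegree_finsetSum_le fun i _ => ?_
  simp [MvPolynomial.totalDegree_X_pow]

/-- Symmetrized powers. -/
noncomputable def Sy (d : ℕ) : ℕ → MvPolynomial (Fin d) C(Ed d, ℝ)
  | 0 => 2
  | 1 => 2 * lina d
  | (l + 2) => 2 * lina d * Sy d (l + 1) - (lina d ^ 2 - sqb d) * Sy d l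

lemma two_deg (d : ℕ) : (2 : MvPolynomial (Fin d) C(Ed d, ℝ)).totalDegree = 0 := by
  have : (2 : MvPolynomial (Fin d) C(Ed d, ℝ)) = MvPolynomial.C 2 :=
    (map_ofNat (MvPolynomial.C : C(Ed d, ℝ) →+* MvPolynomial (Fin d) C(Ed d, ℝ)) 2).symm
  rw [this, MvPolynomial.totalDegree_C]

lemma Sy_deg (d : ℕ) : ∀ l, (Sy d l).totalDegree ≤ l
  | 0 => by rw [Sy, two_deg]
  | 1 => by
    rw [Sy]
    refine (MvPolynomial.totalDegree_mul _ _).trans ?_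
    rw [two_deg]; simpa using lina_deg d
  | (l + 2) => by
    rw [Sy]
    have h1 := Sy_deg d l
    have h2 := Sy_deg d (l + 1)
    have h3 : (2 * lina d).totalDegree ≤ 1 := by
      refine (MvPolynomial.totalDegree_mul _ _).trans ?_
      rw [two_deg]; simpa using lina_deg d
    have h4 : (lina d ^ 2 - sqb d).totalDegree ≤ 2 := by
      refine (MvPolynomial.totalDegree_sub _ _).trans (max_le ?_ (sqb_deg d))
      refine (MvPolynomial.totalDegree_pow _ _).trans ?_
      have := lina_deg d
      omega
    refine (MvPolynomial.totalDegree_sub _ _).trans (max_le ?_ ?_)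
    · refine (MvPolynomial.totalDegree_mul _ _).trans ?_
      omega
    · refine (MvPolynomial.totalDegree_mul _ _).trans ?_
      omega

lemma Sy_ev {d : ℕ} (x : Fin d → ℝ) (y : Ed d) (z : ℝ) (hz : z ^ 2 = 1 - ∑ i, x i ^ 2) : ∀ l,
    ev2 x y (Sy d l) = (∑ i, x i * y i.castSucc + z * y (Fin.last d)) ^ l
      + (∑ i, x i * y i.castSucc - z * y (Fin.last d)) ^ l
  | 0 => by rw [Sy, map_ofNat (ev2 x y) 2]; norm_num
  | 1 => by rw [Sy, map_mul, lina_ev, map_ofNat (ev2 x y) 2]; ring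
  | (l + 2) => by
    rw [Sy, map_sub, map_mul, map_mul, map_mul, map_sub, map_pow, sqb_ev, lina_ev, Sy_ev x y z hz l,
      Sy_ev x y z hz (l + 1), ← hz]
    simp only [map_ofNat]
    ring

/-- Integrate coefficients. -/
noncomputable def intP {d : ℕ} (G : Ed d → ℝ) (P : MvPolynomial (Fin d) C(Ed d, ℝ)) :
    MvPolynomial (Fin d) ℝ :=
  ∑ m ∈ P.support, MvPolynomial.monomial m (∫ y, P.coeff m y * G y ∂(sph (Ed d)))

lemma intP_deg {d : ℕ} (G : Ed d → ℝ) (P : MvPolynomial (Fin d) C(Ed d, ℝ)) :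
    (intP G P).totalDegree ≤ P.totalDegree := by
  unfold intP
  refine MvPolynomial.totalDegree_finsetSum_le fun m hm => ?_
  exact (MvPolynomial.totalDegree_monomial_le _ _).trans (MvPolynomial.le_totalDegree hm)

lemma intP_ev {d : ℕ} {G : Ed d → ℝ} (hG : ContinuousOn G (sphere 0 1))
    (P : MvPolynomial (Fin d) C(Ed d, ℝ)) (x : Fin d → ℝ) :
    MvPolynomial.eval x (intP G P) = ∫ y, ev2 x y P * G y ∂(sph (Ed d)) := by
  have hi : ∀ m, Integrable (fun y => P.coeff m y * G y) (sph (Ed d)) := fun m =>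
    sph_integrable ((P.coeff m).continuous.continuousOn.mul hG)
  have : ∀ y, ev2 x y P * G y = ∑ m ∈ P.support, (P.coeff m y * G y) * ∏ i, x i ^ m i := by
    intro y
    rw [ev2, MvPolynomial.coe_eval₂Hom, MvPolynomial.eval₂_eq', Finset.sum_mul]
    refine Finset.sum_congr rfl fun m _ => ?_
    have : evy y (P.coeff m) = P.coeff m y := rfl
    rw [this]; ring
  simp only [this]
  rw [integral_finsetSum _ fun m _ => (hi m).mul_const _, intP, map_sum]
  refine Finset.sum_congr rfl fun m _ => ?_
  rw [MvPolynomial.eval_monomial, integral_mul_const]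
  congr 1
  rw [Finsupp.prod_fintype]
  simp

/-- Lift of a point of the ball. -/
noncomputable def lft {d : ℕ} (x : Fin d → ℝ) (z : ℝ) : Ed d := WithLp.toLp 2 (Fin.snoc x z)

lemma lft_inner {d : ℕ} (x : Fin d → ℝ) (z : ℝ) (y : Ed d) :
    inner ℝ (lft x z) y = ∑ i, x i * y i.castSucc + z * y (Fin.last d) := by
  rw [PiLp.inner_apply, Fin.sum_univ_castSucc]
  simp [lft, mul_comm]

lemma lft_norm {d : ℕ} (x : Fin d → ℝ) (z : ℝ) (hz : z ^ 2 = 1 - ∑ i, x i ^ 2) :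
    ‖lft x z‖ = 1 := by
  have : ‖lft x z‖ ^ 2 = 1 := by
    rw [← real_inner_self_eq_norm_sq, lft_inner]
    simp [lft]
    have : ∑ i, x i * x i = ∑ i, x i ^ 2 := by simp [pow_two]
    rw [this]; linarith
  nlinarith [norm_nonneg (lft x z)]

/-- Projection to the first coordinates. -/
noncomputable def prj (d : ℕ) : Ed d →L[ℝ] (Fin d → ℝ) :=
  ContinuousLinearMap.pi fun i => EuclideanSpace.proj i.castSucc

lemma prj_lft {d : ℕ} (x : Fin d → ℝ) (z : ℝ) : prj d (lft x z) = x := by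
  ext i; simp [prj, lft]

lemma prj_le {d : ℕ} (x : Ed d) : ∑ i, (prj d x i) ^ 2 ≤ ‖x‖ ^ 2 := by
  rw [EuclideanSpace.norm_sq_eq, Fin.sum_univ_castSucc]
  have : ∀ i, prj d x i = x i.castSucc := fun i => rfl
  simp only [this, Real.norm_eq_abs, sq_abs]
  nlinarith [sq_nonneg (x (Fin.last d))]

lemma Qop_sym {d n : ℕ} {G : Ed d → ℝ} (hG : ContinuousOn G (sphere 0 1)) :
    ∃ p : MvPolynomial (Fin d) ℝ, p.totalDegree ≤ pE (Ed d) * n ∧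
      ∀ (x : Fin d → ℝ) (z : ℝ), z ^ 2 = 1 - ∑ i, x i ^ 2 →
        MvPolynomial.eval x p = Qop n G (lft x z) + Qop n G (lft x (-z)) := by
  let P : MvPolynomial (Fin d) C(Ed d, ℝ) := ∑ l ∈ Finset.range (pE (Ed d) * n + 1),
    MvPolynomial.C (ContinuousMap.const _ ((Kn (Ed d) n).coeff l)) * Sy d l
  have hdeg : (Kn (Ed d) n).natDegree < pE (Ed d) * n + 1 := by
    refine Nat.lt_succ_of_le ?_
    unfold Kn
    refine Polynomial.natDegree_pow_le.trans ?_
    exact Nat.mul_le_mul_left _ (Dk_deg n)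
  refine ⟨intP G P, (intP_deg G P).trans ?_, fun x z hz => ?_⟩
  · refine MvPolynomial.totalDegree_finsetSum_le fun l hl => ?_
    refine (MvPolynomial.totalDegree_mul _ _).trans ?_
    rw [MvPolynomial.totalDegree_C, zero_add]
    have := Sy_deg d l
    have := Finset.mem_range.1 hl
    omega
  · rw [intP_ev hG]
    unfold Qop
    rw [← integral_add (KF_int n hG _) (KF_int n hG _)]
    refine integral_congr_ae (Filter.Eventually.of_forall fun y => ?_)
    simp only
    rw [← add_mul]
    congr 1
    rw [Polynomial.eval_eq_sum_range' hdeg, Polynomial.eval_eq_sum_range' hdeg,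
      ← Finset.sum_add_distrib, map_sum]
    refine Finset.sum_congr rfl fun l _ => ?_
    rw [map_mul, Sy_ev x y z hz, lft_inner, lft_inner]
    have : ev2 x y (MvPolynomial.C (ContinuousMap.const _ ((Kn (Ed d) n).coeff l)))
        = (Kn (Ed d) n).coeff l := by
      rw [ev2, MvPolynomial.coe_eval₂Hom, MvPolynomial.eval₂_C]; rfl
    rw [this]
    ring

theorem jackson (d s : ℕ) : ∃ C > (0:ℝ), ∃ c : ℕ, 1 ≤ c ∧ ∀ (U : Set (Fin d → ℝ)), IsOpen U →
    {x : Fin d → ℝ | (∑ i, (x i) ^ 2) ≤ 1} ⊆ U → ∀ f : (Fin d → ℝ) → ℝ, Good U s f →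
    ∀ n : ℕ, 1 ≤ n → ∃ p : MvPolynomial (Fin d) ℝ, p.totalDegree ≤ c * n ∧
      ∀ x : Fin d → ℝ, (∑ i, (x i) ^ 2) ≤ 1 → |MvPolynomial.eval x p - f x| ≤ C * ((n:ℝ) ^ s)⁻¹ := by
  obtain ⟨C, hC, hT⟩ := Terr_iter (Ed d)
  refine ⟨C ^ s * cB d s, mul_pos (pow_pos hC s) (cB_pos d s), pE (Ed d), by unfold pE; omega, ?_⟩
  intro U hU hB f hf n hn
  set F : Ed d → ℝ := fun y => f (prj d y) with hF
  have hW : Wc s (cB d s) F := good_Wc hU hB s hf (prj d) prj_le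
  have hFc : ContinuousOn F (sphere 0 1) := by
    refine hf.1.continuousOn.comp (prj d).continuous.continuousOn fun y hy => hB ?_
    have h1 : ‖y‖ = 1 := by simpa using hy
    have := prj_le y
    rw [h1] at this
    simpa using this
  choose p hp1 hp2 using fun i => Qop_sym (n := n) (Terr_iter_cont n hFc i)
  obtain ⟨x0, hx0⟩ : ∃ x : Ed d, ‖x‖ = 1 := exists_norm_eq _ zero_le_one
  refine ⟨∑ i ∈ Finset.range s, MvPolynomial.C (1 / 2 / Zn n x0) * p i, ?_, fun x hx => ?_⟩
  · refine MvPolynomial.totalDegree_finsetSum_le fun l hl => ?_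
    refine (MvPolynomial.totalDegree_mul _ _).trans ?_
    rw [MvPolynomial.totalDegree_C, zero_add]
    exact hp1 l
  · set z := Real.sqrt (1 - ∑ i, x i ^ 2)
    have hz : z ^ 2 = 1 - ∑ i, x i ^ 2 := Real.sq_sqrt (by linarith)
    have hz' : (-z) ^ 2 = 1 - ∑ i, x i ^ 2 := by rw [neg_sq, hz]
    have n1 := lft_norm x z hz
    have n2 := lft_norm x (-z) hz'
    have e1 := Terr_telescope n F s (lft x z)
    have e2 := Terr_telescope n F s (lft x (-z))
    have b1 := hT n hn s _ F hFc hW _ n1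
    have b2 := hT n hn s _ F hFc hW _ n2
    have f1 : F (lft x z) = f x := by simp only [hF, prj_lft]
    have f2 : F (lft x (-z)) = f x := by simp only [hF, prj_lft]
    rw [Zn_const n n1 hx0, f1] at e1
    rw [Zn_const n n2 hx0, f2] at e2
    have key : MvPolynomial.eval x (∑ i ∈ Finset.range s, MvPolynomial.C (1 / 2 / Zn n x0) * p i)
        - f x = - ((Terr n)^[s] F (lft x z) + (Terr n)^[s] F (lft x (-z))) / 2 := by
      have : MvPolynomial.eval x (∑ i ∈ Finset.range s, MvPolynomial.C (1 / 2 / Zn n x0) * p i)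
          = (∑ i ∈ Finset.range s, Qop n ((Terr n)^[i] F) (lft x z) / Zn n x0
            + ∑ i ∈ Finset.range s, Qop n ((Terr n)^[i] F) (lft x (-z)) / Zn n x0) / 2 := by
        rw [map_sum, ← Finset.sum_add_distrib, Finset.sum_div]
        refine Finset.sum_congr rfl fun i _ => ?_
        rw [map_mul, MvPolynomial.eval_C, hp2 i x z hz]
        ring
      rw [this, ← e1, ← e2]
      ring
    rw [key]
    have : C ^ s * cB d s * ((n:ℝ) ^ s)⁻¹ = (C / n) ^ s * cB d s := by
      rw [div_pow]; ring
    rw [this, abs_le]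
    rw [abs_le] at b1 b2
    constructor <;> linarith

end Jackson


section Poly

/-- Signed binomial weights. -/
noncomputable def wt (a m : ℕ) : ℝ := (-1) ^ (a - m) * (a.choose m : ℝ)

lemma wt_sum {k a : ℕ} (hak : a ≤ k) (b : ℕ) :
    ∑ m : Fin (k + 1), wt a m * (m : ℝ) ^ b = (fwdDiff (1:ℝ))^[a] (fun r : ℝ => r ^ b) 0 := by
  rw [fwdDiff_iter_eq_sum_shift, Fin.sum_univ_eq_sum_range (fun m => wt a m * (m : ℝ) ^ b) (k + 1)]
  symm
  rw [← Finset.sum_subset (Finset.range_mono (Nat.succ_le_succ hak))]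
  · refine Finset.sum_congr rfl fun m _ => ?_
    simp [wt]
  · intro m _ hm
    have : a < m := by simpa using hm
    simp [wt, Nat.choose_eq_zero_of_lt this]

lemma wt_lt {k a b : ℕ} (hak : a ≤ k) (h : b < a) :
    ∑ m : Fin (k + 1), wt a m * (m : ℝ) ^ b = 0 := by
  rw [wt_sum hak, fwdDiff_iter_pow_eq_zero_of_lt h]; rfl

lemma wt_eq {k a : ℕ} (hak : a ≤ k) :
    ∑ m : Fin (k + 1), wt a m * (m : ℝ) ^ a = a.factorial := by
  rw [wt_sum hak, fwdDiff_iter_eq_factorial]; rfl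

lemma wt_multi {d k : ℕ} (α : Fin d → ℕ) (hα : ∀ i, α i ≤ k) (x : Fin d → ℝ) (l : ℕ)
    (hl : l ≤ ∑ i, α i) :
    ∑ j : Fin d → Fin (k + 1), (∏ i, wt (α i) (j i)) * (∑ i, (j i : ℝ) * x i) ^ l =
      if l = ∑ i, α i then ((∑ i, α i).factorial : ℝ) * ∏ i, x i ^ α i else 0 := by
  have h1 : ∑ j : Fin d → Fin (k + 1), (∏ i, wt (α i) (j i)) * (∑ i, (j i : ℝ) * x i) ^ l =
      ∑ β ∈ Finset.univ.piAntidiag l, (Nat.multinomial Finset.univ β : ℝ) * (∏ i, x i ^ β i) *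
        ∏ i, ∑ m : Fin (k + 1), wt (α i) m * (m : ℝ) ^ β i := by
    simp only [Finset.sum_pow_eq_sum_piAntidiag, Finset.mul_sum, Fintype.prod_sum]
    rw [Finset.sum_comm]
    refine Finset.sum_congr rfl fun β _ => Finset.sum_congr rfl fun j _ => ?_
    simp only [mul_pow, Finset.prod_mul_distrib]
    ring
  rw [h1]
  have h2 : ∀ β ∈ Finset.univ.piAntidiag l, β ≠ α →
      (Nat.multinomial Finset.univ β : ℝ) * (∏ i, x i ^ β i) *
        ∏ i, ∑ m : Fin (k + 1), wt (α i) m * (m : ℝ) ^ β i = 0 := by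
    intro β hβ hne
    have hs : ∑ i, β i = l := (Finset.mem_piAntidiag.1 hβ).1
    have : ∃ i, β i < α i := by
      by_contra hcon
      push Not at hcon
      have hle : ∑ i, α i ≤ ∑ i, β i := Finset.sum_le_sum fun i _ => hcon i
      have heq : ∑ i, α i = ∑ i, β i := by omega
      have := (Finset.sum_eq_sum_iff_of_le fun i _ => hcon i).1 heq
      exact hne (funext fun i => (this i (Finset.mem_univ i)).symm)
    obtain ⟨i, hi⟩ := this
    exact mul_eq_zero_of_right _ (Finset.prod_eq_zero (Finset.mem_univ i) (wt_lt (hα i) hi))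
  split_ifs with hla
  · rw [Finset.sum_eq_single α h2]
    · simp only [wt_eq (hα _)]
      rw [← Nat.multinomial_spec]
      push_cast
      ring
    · intro h
      exact absurd (Finset.mem_piAntidiag.2 ⟨hla.symm, by simp⟩) h
  · refine Finset.sum_eq_zero fun β hβ => h2 β hβ ?_
    rintro rfl
    exact hla (Finset.mem_piAntidiag.1 hβ).1.symm

lemma ball_coord {d : ℕ} {x : Fin d → ℝ} (hx : (∑ i, (x i) ^ 2) ≤ 1) (i : Fin d) : |x i| ≤ 1 := by
  have : x i ^ 2 ≤ 1 := (Finset.single_le_sum (f := fun i => x i ^ 2)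
    (fun i _ => sq_nonneg _) (Finset.mem_univ i)).trans hx
  exact abs_le_one_iff_mul_self_le_one.2 (by nlinarith)

lemma dot_le {d k : ℕ} {x : Fin d → ℝ} (hx : (∑ i, (x i) ^ 2) ≤ 1) (j : Fin d → Fin (k + 1)) :
    |∑ i, (j i : ℝ) * x i| ≤ d * k := by
  refine (Finset.abs_sum_le_sum_abs _ _).trans ?_
  have : ∀ i ∈ Finset.univ, |(j i : ℝ) * x i| ≤ (k : ℝ) := by
    intro i _
    rw [abs_mul, Nat.abs_cast]
    have h1 : ((j i : ℕ) : ℝ) ≤ k := by exact_mod_cast Nat.lt_succ_iff.1 (j i).2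
    have := ball_coord hx i
    nlinarith [abs_nonneg (x i), Nat.cast_nonneg (α := ℝ) (j i : ℕ)]
  simpa using Finset.sum_le_sum this

/-- Functions on the ball approximable by simple fractions. -/
def Apx (d k : ℕ) (g : (Fin d → ℝ) → ℝ) : Prop :=
  ∀ ε > (0:ℝ), ∃ h0 > (0:ℝ), ∀ h : ℝ, 0 < h → h < h0 → ∃ c : (Fin d → Fin (k + 1)) → ℝ,
    ∀ x : Fin d → ℝ, (∑ i, (x i) ^ 2) ≤ 1 →
      |∑ j, c j / (1 + h * ∑ i, (j i : ℝ) * x i) - g x| ≤ ε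

lemma Apx.add {d k : ℕ} {f g : (Fin d → ℝ) → ℝ} (hf : Apx d k f) (hg : Apx d k g) :
    Apx d k (fun x => f x + g x) := by
  intro ε hε
  obtain ⟨h1, h1p, H1⟩ := hf (ε / 2) (by positivity)
  obtain ⟨h2, h2p, H2⟩ := hg (ε / 2) (by positivity)
  refine ⟨min h1 h2, lt_min h1p h2p, fun h hp hh => ?_⟩
  obtain ⟨c1, C1⟩ := H1 h hp (hh.trans_le (min_le_left _ _))
  obtain ⟨c2, C2⟩ := H2 h hp (hh.trans_le (min_le_right _ _))
  refine ⟨fun j => c1 j + c2 j, fun x hx => ?_⟩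
  have a1 := C1 x hx
  have a2 := C2 x hx
  simp only [add_div, Finset.sum_add_distrib]
  rw [abs_le] at *
  constructor <;> linarith

lemma Apx.zero {d k : ℕ} : Apx d k (fun _ => 0) := by
  intro ε hε
  exact ⟨1, one_pos, fun h _ _ => ⟨fun _ => 0, fun x _ => by simpa using hε.le⟩⟩

lemma Apx.smul {d k : ℕ} {f : (Fin d → ℝ) → ℝ} (hf : Apx d k f) (a : ℝ) :
    Apx d k (fun x => a * f x) := by
  intro ε hε
  obtain ⟨h1, h1p, H1⟩ := hf (ε / (|a| + 1)) (by positivity)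
  refine ⟨h1, h1p, fun h hp hh => ?_⟩
  obtain ⟨c1, C1⟩ := H1 h hp hh
  refine ⟨fun j => a * c1 j, fun x hx => ?_⟩
  have a1 := C1 x hx
  simp only [mul_div_assoc, ← Finset.mul_sum]
  rw [← mul_sub, abs_mul]
  rw [le_div_iff₀ (by positivity)] at a1
  nlinarith [abs_nonneg (∑ j, c1 j / (1 + h * ∑ i, (j i : ℝ) * x i) - f x), abs_nonneg a]

lemma Apx.sum {d k : ℕ} {ι : Type*} (s : Finset ι) {f : ι → (Fin d → ℝ) → ℝ}
    (hf : ∀ i ∈ s, Apx d k (f i)) : Apx d k (fun x => ∑ i ∈ s, f i x) := by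
  classical
  induction s using Finset.induction_on with
  | empty => simpa using Apx.zero
  | insert a s ha ih =>
    simp only [Finset.sum_insert ha]
    exact (hf a (by simp)).add (ih fun i hi => hf i (by simp [hi]))

lemma frac_expand {v : ℝ} (hv : |v| ≤ 1 / 2) (L : ℕ) :
    1 / (1 + v) = ∑ l ∈ Finset.range (L + 1), (-v) ^ l + (-v) ^ (L + 1) / (1 + v) := by
  rw [abs_le] at hv
  have : (1 + v) ≠ 0 := by linarith
  have h := mul_neg_geom_sum (-v) (L + 1)
  rw [sub_neg_eq_add] at h
  field_simp
  linarith

lemma Apx.mono {d k : ℕ} (α : Fin d → ℕ) (hα : ∀ i, α i ≤ k) :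
    Apx d k (fun x => ∏ i, x i ^ α i) := by
  intro ε hε
  set L := ∑ i, α i with hL
  set a : (Fin d → Fin (k + 1)) → ℝ := fun j => ∏ i, wt (α i) (j i) with ha
  set D : ℝ := d * k with hD
  have hD0 : 0 ≤ D := by positivity
  set M : ℝ := (∑ j, |a j|) * (2 * D ^ (L + 1)) with hM
  have hM0 : 0 ≤ M := by positivity
  refine ⟨min (1 / (2 * (D + 1))) (ε / (M + 1)), by positivity, fun h hp hh => ?_⟩
  have hh1 : h * D ≤ 1 / 2 := by
    have := hh.trans_le (min_le_left _ _)
    rw [lt_div_iff₀ (by positivity)] at this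
    nlinarith
  have hh2 : h * M ≤ ε := by
    have := hh.trans_le (min_le_right _ _)
    rw [lt_div_iff₀ (by positivity)] at this
    nlinarith
  have hLf : (1:ℝ) ≤ (L.factorial : ℝ) := by exact_mod_cast Nat.factorial_pos L
  have hhL : (-h) ^ L ≠ 0 := pow_ne_zero _ (by linarith)
  refine ⟨fun j => a j / (L.factorial * (-h) ^ L), fun x hx => ?_⟩
  have hv : ∀ j : Fin d → Fin (k + 1), |h * ∑ i, (j i : ℝ) * x i| ≤ 1 / 2 := by
    intro j
    rw [abs_mul, abs_of_pos hp]
    exact (mul_le_mul_of_nonneg_left (dot_le hx j) hp.le).trans hh1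
  set r : (Fin d → Fin (k + 1)) → ℝ := fun j =>
    (-(h * ∑ i, (j i : ℝ) * x i)) ^ (L + 1) / (1 + h * ∑ i, (j i : ℝ) * x i) with hr
  have hrb : ∀ j, |r j| ≤ h ^ (L + 1) * (2 * D ^ (L + 1)) := by
    intro j
    have h1 := hv j
    have h2 := abs_le.1 h1
    rw [hr]
    simp only
    rw [abs_div, abs_pow, abs_neg, abs_of_pos (a := 1 + _) (by linarith), div_le_iff₀ (by linarith)]
    have h3 : |h * ∑ i, (j i : ℝ) * x i| ^ (L + 1) ≤ h ^ (L + 1) * D ^ (L + 1) := by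
      rw [← mul_pow]
      refine pow_le_pow_left₀ (abs_nonneg _) ?_ _
      rw [abs_mul, abs_of_pos hp]
      exact mul_le_mul_of_nonneg_left (dot_le hx j) hp.le
    have h4 : 0 ≤ h ^ (L + 1) * D ^ (L + 1) := by positivity
    nlinarith
  have hmain : ∑ j, a j / (1 + h * ∑ i, (j i : ℝ) * x i)
      = (L.factorial * (-h) ^ L) * ∏ i, x i ^ α i + ∑ j, a j * r j := by
    have e1 : ∀ j, a j / (1 + h * ∑ i, (j i : ℝ) * x i) =
        ∑ l ∈ Finset.range (L + 1), (-h) ^ l * (a j * (∑ i, (j i : ℝ) * x i) ^ l) + a j * r j := by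
      intro j
      rw [div_eq_mul_one_div, frac_expand (hv j) L, mul_add, Finset.mul_sum]
      congr 1
      refine Finset.sum_congr rfl fun l _ => ?_
      rw [← neg_mul, mul_pow]; ring
    simp only [e1]
    rw [Finset.sum_add_distrib, Finset.sum_comm]
    congr 1
    simp only [← Finset.mul_sum]
    rw [Finset.sum_range_succ, Finset.sum_eq_zero, zero_add, wt_multi α hα x L le_rfl, if_pos rfl]
    · ring
    · intro l hl
      have hl' := Finset.mem_range.1 hl
      rw [wt_multi α hα x l hl'.le, if_neg hl'.ne, mul_zero]
  have hq : ∑ j, a j / (L.factorial * (-h) ^ L) / (1 + h * ∑ i, (j i : ℝ) * x i) - ∏ i, x i ^ α i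
      = (∑ j, a j * r j) / (L.factorial * (-h) ^ L) := by
    have : ∑ j, a j / (L.factorial * (-h) ^ L) / (1 + h * ∑ i, (j i : ℝ) * x i) =
        (∑ j, a j / (1 + h * ∑ i, (j i : ℝ) * x i)) / (L.factorial * (-h) ^ L) := by
      rw [Finset.sum_div]
      refine Finset.sum_congr rfl fun j _ => ?_
      rw [div_right_comm]
    rw [this, hmain]
    have : (L.factorial * (-h) ^ L : ℝ) ≠ 0 := mul_ne_zero (by positivity) hhL
    field_simp
    ring
  rw [hq, abs_div, abs_mul, abs_pow, abs_neg, abs_of_pos hp, Nat.abs_cast,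
    div_le_iff₀ (by positivity)]
  calc |∑ j, a j * r j| ≤ ∑ j, |a j| * (h ^ (L + 1) * (2 * D ^ (L + 1))) := by
        refine (Finset.abs_sum_le_sum_abs _ _).trans (Finset.sum_le_sum fun j _ => ?_)
        rw [abs_mul]
        exact mul_le_mul_of_nonneg_left (hrb j) (abs_nonneg _)
    _ = (h * M) * h ^ L := by rw [← Finset.sum_mul, hM]; ring
    _ ≤ ε * h ^ L := mul_le_mul_of_nonneg_right hh2 (by positivity)
    _ ≤ ε * (L.factorial * h ^ L) := by
        have : 0 < h ^ L := by positivity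
        have : h ^ L ≤ L.factorial * h ^ L := by nlinarith
        exact mul_le_mul_of_nonneg_left this hε.le

lemma Apx.poly {d k : ℕ} (p : MvPolynomial (Fin d) ℝ) (hp : p.totalDegree ≤ k) :
    Apx d k (fun x => MvPolynomial.eval x p) := by
  simp only [MvPolynomial.eval_eq']
  refine Apx.sum _ fun m hm => (Apx.mono _ fun i => ?_).smul _
  have h1 := (MvPolynomial.le_totalDegree hm).trans hp
  rw [Finsupp.sum_fintype _ _ (by simp)] at h1
  exact (Finset.single_le_sum (f := fun i => m i) (fun _ _ => Nat.zero_le _)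
    (Finset.mem_univ i)).trans h1

end Poly


section Net

/-- The input pattern of one block. -/
noncomputable def blk {ns : ℕ} (u : ℝ) (j : Fin ns) : ℝ :=
  if (j : ℕ) = 0 then u else if (j : ℕ) = 1 then -u else if (j : ℕ) = 2 then 1 else 0

/-- The output weights of one block. -/
noncomputable def owt {ns : ℕ} (j : Fin ns) : ℝ :=
  if (j : ℕ) = 0 then 1 else if (j : ℕ) = 1 then 1 else if (j : ℕ) = 2 then -2 else 0

lemma sum3 {m : ℕ} (f : Fin (m + 3) → ℝ) (hf : ∀ j : Fin m, f j.succ.succ.succ = 0) :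
    ∑ j, f j = f ⟨0, by omega⟩ + f ⟨1, by omega⟩ + f ⟨2, by omega⟩ := by
  rw [Fin.sum_univ_succ, Fin.sum_univ_succ, Fin.sum_univ_succ, Finset.sum_eq_zero fun j _ => hf j,
    add_zero, ← add_assoc]
  rfl

lemma blk_sum {ns : ℕ} (hns : 3 ≤ ns) (u : ℝ) : ∑ j : Fin ns, blk u j = 1 := by
  obtain ⟨m, rfl⟩ : ∃ m, ns = m + 3 := ⟨ns - 3, by omega⟩
  rw [sum3 _ (by intro j; simp [blk])]
  simp [blk]

lemma blk_sq {ns : ℕ} (hns : 3 ≤ ns) (u : ℝ) : ∑ j : Fin ns, blk u j ^ 2 = 2 * u ^ 2 + 1 := by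
  obtain ⟨m, rfl⟩ : ∃ m, ns = m + 3 := ⟨ns - 3, by omega⟩
  rw [sum3 _ (by intro j; simp [blk])]
  simp [blk]
  ring

lemma owt_sum {ns : ℕ} (hns : 3 ≤ ns) : ∑ j : Fin ns, owt j = 0 := by
  obtain ⟨m, rfl⟩ : ∃ m, ns = m + 3 := ⟨ns - 3, by omega⟩
  rw [sum3 _ (by intro j; simp [owt])]
  simp [owt]
  norm_num

lemma owt_blk {ns : ℕ} (hns : 3 ≤ ns) (u : ℝ) : ∑ j : Fin ns, owt j * blk u j = -2 := by
  obtain ⟨m, rfl⟩ : ∃ m, ns = m + 3 := ⟨ns - 3, by omega⟩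
  rw [sum3 _ (by intro j; simp [owt])]
  simp [owt, blk]

/-- Shift in the neuron. -/
noncomputable def kap (ns : ℕ) : ℝ := (1 - 1 / (ns : ℝ)) / 2

lemma kap_pos {ns : ℕ} (hns : 3 ≤ ns) : 0 < kap ns := by
  have : (3:ℝ) ≤ ns := by exact_mod_cast hns
  unfold kap
  have : 1 / (ns:ℝ) < 1 := by rw [div_lt_one (by linarith)]; linarith
  linarith

lemma kap_le (ns : ℕ) : kap ns ≤ 1 := by
  unfold kap
  have : 0 ≤ 1 / (ns:ℝ) := by positivity
  linarith

lemma LN_blk {ns : ℕ} (hns : 3 ≤ ns) (u : ℝ) :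
    ∑ j : Fin ns, owt j * LN (blk u) j = -2 / Real.sqrt (2 / ns) * (1 / Real.sqrt (u ^ 2 + kap ns)) := by
  have hn : (3:ℝ) ≤ ns := by exact_mod_cast hns
  have hn0 : (ns:ℝ) ≠ 0 := by linarith
  have hk := kap_pos hns
  have hvar : (∑ i : Fin ns, (blk u i - (∑ i : Fin ns, blk u i) / ns) ^ 2) / ns
      = 2 / ns * (u ^ 2 + kap ns) := by
    have : ∀ i : Fin ns, (blk u i - (∑ i : Fin ns, blk u i) / ns) ^ 2
        = blk u i ^ 2 - 2 / ns * blk u i + 1 / ns ^ 2 := by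
      intro i; rw [blk_sum hns]; ring
    simp only [this]
    rw [Finset.sum_add_distrib, Finset.sum_sub_distrib, ← Finset.mul_sum, blk_sum hns, blk_sq hns]
    simp [kap]
    field_simp
    ring
  have hpos : 0 < 2 / (ns:ℝ) * (u ^ 2 + kap ns) := by positivity
  have hs : 0 < Real.sqrt (2 / ns * (u ^ 2 + kap ns)) := Real.sqrt_pos.2 hpos
  unfold LN
  simp only [hvar]
  rw [if_neg hs.ne']
  have : ∀ j : Fin ns, owt j * ((blk u j - (∑ i : Fin ns, blk u i) / ns) /
      Real.sqrt (2 / ns * (u ^ 2 + kap ns))) = (owt j * blk u j - owt j * (1 / ns)) /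
      Real.sqrt (2 / ns * (u ^ 2 + kap ns)) := by
    intro j; rw [blk_sum hns]; ring
  simp only [this]
  rw [← Finset.sum_div, Finset.sum_sub_distrib, ← Finset.sum_mul, owt_blk hns, owt_sum hns,
    Real.sqrt_mul (by positivity)]
  have h1 : 0 < Real.sqrt (2 / ns) := Real.sqrt_pos.2 (by positivity)
  have h2 : 0 < Real.sqrt (u ^ 2 + kap ns) := Real.sqrt_pos.2 (by positivity)
  field_simp
  ring

lemma net_exists {d ns N : ℕ} (hns : 3 ≤ ns) (w : Fin N → Fin d → ℝ) (b c : Fin N → ℝ) :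
    ∃ (W₁ : Matrix (Fin (N * ns)) (Fin d) ℝ) (b₁ : Fin (N * ns) → ℝ) (W₂ : Fin (N * ns) → ℝ),
      ∀ x : Fin d → ℝ, ∑ i, W₂ i * PLN ns N (W₁.mulVec x + b₁) i =
        ∑ B, c B * (1 / Real.sqrt ((∑ i, w B i * x i + b B) ^ 2 + kap ns)) := by
  have hn : (3:ℝ) ≤ ns := by exact_mod_cast hns
  have h1 : 0 < Real.sqrt (2 / (ns:ℝ)) := Real.sqrt_pos.2 (by positivity)
  have hdm : ∀ (B : Fin N) (j : Fin ns), (finProdFinEquiv (B, j)).divNat = B ∧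
      (finProdFinEquiv (B, j)).modNat = j := by
    intro B j
    have := finProdFinEquiv.symm_apply_apply (B, j)
    rw [finProdFinEquiv_symm_apply] at this
    exact ⟨congrArg Prod.fst this, congrArg Prod.snd this⟩
  refine ⟨fun i k => if (i.modNat : ℕ) = 0 then w i.divNat k else
      if (i.modNat : ℕ) = 1 then - w i.divNat k else 0,
    fun i => blk (b i.divNat) i.modNat,
    fun i => c i.divNat * (Real.sqrt (2 / ns) / (-2)) * owt i.modNat, fun x => ?_⟩
  rw [← finProdFinEquiv.sum_comp, Fintype.sum_prod_type]
  refine Finset.sum_congr rfl fun B _ => ?_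
  have hb : (fun j : Fin ns => ((Matrix.mulVec (fun (i : Fin (N * ns)) (k : Fin d) =>
      if (i.modNat : ℕ) = 0 then w i.divNat k else
      if (i.modNat : ℕ) = 1 then - w i.divNat k else 0) x) + fun i : Fin (N * ns) => blk (b i.divNat) i.modNat)
      (finProdFinEquiv (B, j))) = blk (∑ i, w B i * x i + b B) := by
    funext j
    simp only [Pi.add_apply, Matrix.mulVec, dotProduct, (hdm B j).1, (hdm B j).2, blk]
    split_ifs
    · rfl
    · simp [Finset.sum_neg_distrib]; ring
    · simp
    · simp
  simp only [PLN, (hdm _ _).1, (hdm _ _).2]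
  rw [hb]
  simp only [mul_assoc]
  rw [← Finset.mul_sum, ← Finset.mul_sum, LN_blk hns]
  field_simp

lemma neuron_err {κ b v : ℝ} (hκ0 : 0 ≤ κ) (hκ1 : κ ≤ 1) (hb : 0 < b) (hv : |v| ≤ 1 / 2) :
    |b * (1 / Real.sqrt ((b * (1 + v)) ^ 2 + κ)) - 1 / (1 + v)| ≤ 8 / b ^ 2 := by
  rw [abs_le] at hv
  have hv1 : 1 / 2 ≤ 1 + v := by linarith
  set t := b * (1 + v) with ht
  have ht0 : b / 2 ≤ t := by rw [ht]; nlinarith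
  have htp : 0 < t := by linarith
  set q := Real.sqrt (t ^ 2 + κ) with hq
  have hq1 : t ≤ q := Real.le_sqrt_of_sq_le (by linarith)
  have hq2 : q ^ 2 = t ^ 2 + κ := Real.sq_sqrt (by positivity)
  have hqp : 0 < q := by linarith
  have e : b * (1 / q) - 1 / (1 + v) = - (b * (κ / (t * q * (q + t)))) := by
    have h1 : 1 / (1 + v) = b / t := by rw [ht]; field_simp
    rw [h1]
    have h2 : κ = (q - t) * (q + t) := by nlinarith
    rw [h2]
    field_simp
    ring
  rw [e, abs_neg, abs_of_nonneg (by positivity), mul_div_assoc', div_le_div_iff₀ (by positivity) (by positivity)]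
  have h3 : (b / 2) ^ 3 ≤ t ^ 3 := pow_le_pow_left₀ (by positivity) ht0 3
  have h4 : t ^ 3 ≤ t * q * (q + t) := by nlinarith [mul_pos htp htp, mul_pos htp hqp]
  have h5 : b * κ * b ^ 2 ≤ b ^ 3 := by
    have : 0 < b ^ 3 := by positivity
    nlinarith
  nlinarith

lemma poly_net {d ns N k : ℕ} (hns : 3 ≤ ns) (hN : (k + 1) ^ d ≤ N) (p : MvPolynomial (Fin d) ℝ)
    (hp : p.totalDegree ≤ k) (ε : ℝ) (hε : 0 < ε) :
    ∃ (W₁ : Matrix (Fin (N * ns)) (Fin d) ℝ) (b₁ : Fin (N * ns) → ℝ) (W₂ : Fin (N * ns) → ℝ),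
      ∀ x : Fin d → ℝ, (∑ i, (x i) ^ 2) ≤ 1 →
        |∑ i, W₂ i * PLN ns N (W₁.mulVec x + b₁) i - MvPolynomial.eval x p| ≤ ε := by
  obtain ⟨h0, h0p, H⟩ := Apx.poly p hp (ε / 2) (by positivity)
  obtain ⟨h, hhp, hh⟩ := exists_between (lt_min h0p (show (0:ℝ) < 1 / (2 * (d * k + 1)) by positivity))
  obtain ⟨c, hc⟩ := H h hhp (hh.trans_le (min_le_left _ _))
  have hD : h * (d * k) ≤ 1 / 2 := by
    have := hh.trans_le (min_le_right _ _)
    rw [lt_div_iff₀ (by positivity)] at this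
    nlinarith
  obtain ⟨e⟩ : Nonempty ((Fin d → Fin (k + 1)) ↪ Fin N) :=
    Function.Embedding.nonempty_of_card_le (by simpa using hN)
  set S := ∑ j, |c j| with hS
  have hS0 : 0 ≤ S := by positivity
  set b : ℝ := 1 + 16 * S / ε with hb
  have hb1 : 1 ≤ b := by rw [hb]; have : 0 ≤ 16 * S / ε := by positivity
                         linarith
  have hbS : S * (8 / b ^ 2) ≤ ε / 2 := by
    rw [mul_div_assoc', div_le_iff₀ (by positivity)]
    have : 16 * S ≤ ε * b := by rw [hb]; field_simp; linarith
    have : b ≤ b ^ 2 := by nlinarith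
    nlinarith
  obtain ⟨W₁, b₁, W₂, hW⟩ := net_exists (d := d) hns
    (Function.extend e (fun j => fun i => b * (h * (j i : ℝ))) 0) (fun _ => b)
    (Function.extend e (fun j => c j * b) 0)
  refine ⟨W₁, b₁, W₂, fun x hx => ?_⟩
  have hv : ∀ j : Fin d → Fin (k + 1), |h * ∑ i, (j i : ℝ) * x i| ≤ 1 / 2 := by
    intro j
    rw [abs_mul, abs_of_pos hhp]
    exact (mul_le_mul_of_nonneg_left (dot_le hx j) hhp.le).trans hD
  have hsum : ∑ i, W₂ i * PLN ns N (W₁.mulVec x + b₁) i = ∑ j, c j * (b *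
      (1 / Real.sqrt ((b * (1 + h * ∑ i, (j i : ℝ) * x i)) ^ 2 + kap ns))) := by
    rw [hW]
    symm
    refine Finset.sum_of_injOn e e.injective.injOn (by simp) ?_ ?_
    · intro B _ hB
      rw [Function.extend_apply' _ _ _ (by rintro ⟨a, ha⟩; exact hB ⟨a, by simp, ha⟩)]
      simp
    · intro j _
      rw [e.injective.extend_apply, e.injective.extend_apply, mul_assoc]
      have : ∑ i, b * (h * (j i : ℝ)) * x i + b = b * (1 + h * ∑ i, (j i : ℝ) * x i) := by
        rw [mul_add, Finset.mul_sum, Finset.mul_sum, mul_one, add_comm]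
        congr 1
        refine Finset.sum_congr rfl fun i _ => by ring
      rw [this]
  have h1 := hc x hx
  have h2 : |∑ i, W₂ i * PLN ns N (W₁.mulVec x + b₁) i -
      ∑ j, c j / (1 + h * ∑ i, (j i : ℝ) * x i)| ≤ ε / 2 := by
    rw [hsum, ← Finset.sum_sub_distrib]
    refine (Finset.abs_sum_le_sum_abs _ _).trans ?_
    refine le_trans ?_ hbS
    rw [hS, Finset.sum_mul]
    refine Finset.sum_le_sum fun j _ => ?_
    rw [div_eq_mul_one_div (c j), ← mul_sub, abs_mul]
    exact mul_le_mul_of_nonneg_left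
      (neuron_err (kap_pos hns).le (kap_le ns) (by linarith) (hv j)) (abs_nonneg _)
  rw [abs_le] at *
  constructor <;> linarith

end Net


lemma rate_aux {d s N : ℕ} (hd : 1 ≤ d) (hN : 1 ≤ N) {T : ℝ} (hT : 0 < T) (h : (N : ℝ) ≤ T ^ d) :
    (T ^ s)⁻¹ ≤ (N : ℝ) ^ (-((s : ℝ) / d)) := by
  have hN' : (0:ℝ) < N := by exact_mod_cast hN
  have hd' : (d:ℝ) ≠ 0 := by positivity
  rw [Real.rpow_neg hN'.le]
  refine inv_anti₀ (Real.rpow_pos_of_pos hN' _) ?_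
  calc (N:ℝ) ^ ((s : ℝ) / d) ≤ (T ^ d) ^ ((s : ℝ) / d) :=
        Real.rpow_le_rpow hN'.le h (by positivity)
    _ = T ^ s := by
        rw [← Real.rpow_natCast T d, ← Real.rpow_mul hT.le, mul_div_cancel₀ _ hd', Real.rpow_natCast]

lemma root_aux {d N : ℕ} (hd : 1 ≤ d) (hN : 1 ≤ N) :
    ∃ k : ℕ, (k + 1) ^ d ≤ N ∧ N < (k + 2) ^ d := by
  have hex : ∃ m, N < (m + 1) ^ d := ⟨N, by
    calc N < N + 1 := Nat.lt_succ_self N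
      _ = (N + 1) ^ 1 := (pow_one _).symm
      _ ≤ (N + 1) ^ d := Nat.pow_le_pow_right (by omega) hd⟩
  classical
  have h1 := Nat.find_spec hex
  rcases hm : Nat.find hex with _ | k
  · rw [hm] at h1
    simp at h1; omega
  · rw [hm] at h1
    have h2 := Nat.find_min hex (m := k) (by omega)
    exact ⟨k, by omega, h1⟩

/-- Approximation rate of shallow PLN-Nets in the closed Euclidean unit ball: there is a
constant `C > 0` depending only on `d` and `s` such that every `f̂` of Sobolev
`W^{s,∞}`-norm at most `1` on `B^d` is approximated with rate `C·N^{−s/d}` by a shallow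
PLN-Net of norm size `n_s ≥ 3` and width `n_s·N`. -/
theorem shallow_PLNNet_sobolev_rate (d s : ℕ) (hd : 1 ≤ d) (hs : 1 ≤ s) :
    ∃ C > (0:ℝ), ∀ ns : ℕ, 3 ≤ ns → ∀ fh : (Fin d → ℝ) → ℝ,
      (∃ U : Set (Fin d → ℝ), IsOpen U ∧ {x | (∑ i, (x i) ^ 2) ≤ 1} ⊆ U ∧
        ContDiffOn ℝ s fh U) →
      (∀ α : Fin d → ℕ, (∑ i, α i) ≤ s →
        ∀ x : Fin d → ℝ, (∑ i, (x i) ^ 2) ≤ 1 → |mpderiv α fh x| ≤ 1) →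
      ∀ N : ℕ, 1 ≤ N →
        ∃ (W₁ : Matrix (Fin (N * ns)) (Fin d) ℝ) (b₁ : Fin (N * ns) → ℝ)
          (W₂ : Fin (N * ns) → ℝ) (b₂ : ℝ),
          ∀ x : Fin d → ℝ, (∑ i, (x i) ^ 2) ≤ 1 →
            |(∑ i, W₂ i * PLN ns N (W₁.mulVec x + b₁) i) + b₂ - fh x|
              ≤ C * (N : ℝ) ^ (-((s : ℝ) / d)) := by
  obtain ⟨CJ, hCJ, c, hc, HJ⟩ := jackson d s
  have hc' : (1:ℝ) ≤ c := by exact_mod_cast hc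
  refine ⟨(CJ + 1) * (3 * c) ^ s, by positivity, ?_⟩
  rintro ns hns fh ⟨U, hU, hB, hf⟩ hα N hN
  have hG : Good U s fh := good_of hU hB hf hα
  obtain ⟨k, hk1, hk2⟩ := root_aux hd hN
  have hk2' : (N:ℝ) ≤ ((k:ℝ) + 2) ^ d := by exact_mod_cast hk2.le
  rcases Nat.eq_zero_or_pos (k / c) with hn | hn
  · have hkc : k < c := by
      rcases Nat.div_eq_zero_iff.1 hn with h | h <;> omega
    have hkc' : (k:ℝ) + 1 ≤ c := by exact_mod_cast hkc
    have hr := rate_aux (s := s) hd hN (T := 3 * c) (by positivity)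
      (hk2'.trans (pow_le_pow_left₀ (by positivity) (by linarith) d))
    refine ⟨0, 0, 0, 0, fun x hx => ?_⟩
    have h1 : |fh x| ≤ 1 := hG.2 [] (by simp) x hx
    simp only [Pi.zero_apply, zero_mul, Finset.sum_const_zero, zero_add, zero_sub, abs_neg]
    have hp : (0:ℝ) < (3 * c) ^ s := by positivity
    rw [inv_le_iff_one_le_mul₀ hp] at hr
    have h2 : (0:ℝ) ≤ CJ := hCJ.le
    nlinarith
  · set n := k / c with hnd
    have hn' : (1:ℝ) ≤ n := by exact_mod_cast hn
    have hcn : c * n ≤ k := Nat.mul_div_le k c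
    have hkn : k < c * (n + 1) := by
      rw [hnd, mul_comm]
      exact Nat.lt_mul_of_div_lt (Nat.lt_succ_self _) hc
    have hkn' : (k:ℝ) + 1 ≤ c * (n + 1) := by exact_mod_cast hkn
    have hr := rate_aux (s := s) hd hN (T := 3 * c * n) (by positivity)
      (hk2'.trans (pow_le_pow_left₀ (by positivity) (by nlinarith) d))
    obtain ⟨p, hp1, hp2⟩ := HJ U hU hB fh hG n hn
    obtain ⟨W₁, b₁, W₂, hW⟩ := poly_net hns hk1 p (hp1.trans hcn) (((n:ℝ) ^ s)⁻¹) (by positivity)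
    refine ⟨W₁, b₁, W₂, 0, fun x hx => ?_⟩
    have a1 := hW x hx
    have a2 := hp2 x hx
    rw [add_zero]
    have a3 : |∑ i, W₂ i * PLN ns N (W₁.mulVec x + b₁) i - fh x| ≤ (CJ + 1) * ((n:ℝ) ^ s)⁻¹ := by
      rw [abs_le] at *
      constructor <;> linarith
    refine a3.trans ?_
    rw [mul_assoc]
    refine mul_le_mul_of_nonneg_left ?_ (by positivity)
    have hp : (0:ℝ) < (3 * c) ^ s := by positivity
    rw [mul_pow, mul_inv] at hr
    calc ((n:ℝ) ^ s)⁻¹ = (3 * c) ^ s * (((3 * c : ℝ) ^ s)⁻¹ * ((n:ℝ) ^ s)⁻¹) := by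
          field_simp
      _ ≤ _ := mul_le_mul_of_nonneg_left hr hp.le
end

section
/- Let p ≥ q ≥ 1 be even integers such that r := p/q is an odd integer, let φ = φ_{p,q}, and let S_{p,q} = {r + pj : j = 0,1,2,…}. Let k ∈ ℕ₀, M > 0, and let s ∈ S_{p,q} (an odd integer). Then for every ε > 0 there exists a shallow φ-network Ψ: [−M, M] → ℝ^{(s+1)/2} of width (s+1)/2 (i.e., Ψ(y) = V φ(wy + b) + c with w, b ∈ ℝ^{(s+1)/2}, V ∈ ℝ^{((s+1)/2)×((s+1)/2)}, c ∈ ℝ^{(s+1)/2}, φ applied elementwise) such that for every n ∈ S_{p,q} with n ≤ s, ‖f_n − Ψ_{(n+1)/2}‖_{W^{k,∞}([−M,M])} ≤ ε, where f_n(y) = y^n and Ψ_{(n+1)/2} is the ((n+1)/2)-th output coordinate of Ψ. -/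
/-- The `(p,q)`-activation `φ_{p,q}(x) = x^{p/q}/(1+x^p)^{1/q}` (for even `p`, so
`x^p ≥ 0`), where `r = p/q`. -/
noncomputable def phipq (p q r : ℕ) (x : ℝ) : ℝ := x ^ r / (1 + x ^ p) ^ ((1 : ℝ) / q)

open Filter Topology in
lemma aux_iter (N : ℕ) (f H : ℝ → ℝ) (hH : AnalyticAt ℝ H 0)
    (hf : f =ᶠ[𝓝 0] fun x => x ^ N * H x) (i : ℕ) :
    ∃ G : ℝ → ℝ, AnalyticAt ℝ G 0 ∧
      iteratedDeriv i f =ᶠ[𝓝 0] fun x => x ^ (N - i) * G x := by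
  induction i with
  | zero => exact ⟨H, hH, by simpa using hf⟩
  | succ i ih =>
    obtain ⟨G, hG, hGe⟩ := ih
    have hd := hGe.deriv
    rw [iteratedDeriv_succ]
    have hev := hG.eventually_analyticAt
    rcases Nat.eq_zero_or_pos (N - i) with h0 | h0
    · refine ⟨deriv G, hG.deriv, hd.trans ?_⟩
      have h1 : N - (i + 1) = 0 := by omega
      simp [h0, h1]
    · obtain ⟨m, hm⟩ : ∃ m, N - i = m + 1 := ⟨N - i - 1, by omega⟩
      have h1 : N - (i + 1) = m := by omega
      refine ⟨fun x => (m + 1) * G x + x * deriv G x,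
        (analyticAt_const.mul hG).add (analyticAt_id.mul hG.deriv), hd.trans ?_⟩
      filter_upwards [hev] with x hx
      have := ((hasDerivAt_pow (m + 1) x).mul hx.differentiableAt.hasDerivAt).deriv
      rw [hm, h1]
      refine Eq.trans this ?_
      push_cast
      ring

open Filter Topology in
lemma aux_bound (N : ℕ) (f H : ℝ → ℝ) (hH : AnalyticAt ℝ H 0)
    (hf : f =ᶠ[𝓝 0] fun x => x ^ N * H x) (i : ℕ) :
    ∃ C : ℝ, 0 ≤ C ∧ ∀ᶠ x in 𝓝 (0 : ℝ), |iteratedDeriv i f x| ≤ C * |x| ^ (N - i) := by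
  obtain ⟨G, hG, hGe⟩ := aux_iter N f H hH hf i
  refine ⟨|G 0| + 1, by positivity, ?_⟩
  have hb : ∀ᶠ x in 𝓝 (0 : ℝ), |G x| < |G 0| + 1 :=
    hG.continuousAt.abs.eventually_lt_const (by linarith)
  filter_upwards [hGe, hb] with x hx hbx
  rw [hx, abs_mul, abs_pow, mul_comm]
  gcongr

lemma aux_choose_ne (q : ℕ) (hq : 1 ≤ q) (m : ℕ) :
    Ring.choose (-((1 : ℝ) / q)) m ≠ 0 := by
  rw [Ring.choose_neg']
  have hpos : 0 < (1 : ℝ) / q := by positivity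
  have h := Ring.factorial_nsmul_multichoose_eq_ascPochhammer ((1 : ℝ) / q) m
  rw [Polynomial.ascPochhammer_smeval_eq_eval] at h
  have h2 := ascPochhammer_pos m _ hpos
  have h3 : Ring.multichoose ((1 : ℝ) / q) m ≠ 0 := by
    intro h0
    rw [h0] at h
    simp at h
    simp at h2
    linarith
  rcases Int.even_or_odd (m : ℤ) with he | ho
  · rw [Int.negOnePow_even _ he]; simpa using h3
  · rw [Int.negOnePow_odd _ ho]; simpa using h3

open Filter Topology in
lemma aux_expand (q : ℕ) (hq : 1 ≤ q) :
    ∃ c : ℕ → ℝ, (∀ m, c m ≠ 0) ∧ ∀ N : ℕ, ∃ G : ℝ → ℝ, AnalyticAt ℝ G 0 ∧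
      ∀ u : ℝ, (1 + u) ^ (-((1 : ℝ) / q)) = ∑ m ∈ Finset.range N, c m * u ^ m + u ^ N * G u := by
  set f : ℝ → ℝ := fun u => (1 + u) ^ (-((1 : ℝ) / q)) with hf
  have hp := Real.one_add_rpow_hasFPowerSeriesAt_zero (a := -((1 : ℝ) / q))
  have hit := fun n => hp.has_fpower_series_iterate_dslope_fslope n
  refine ⟨fun m => ((Function.swap dslope 0)^[m] f) 0, ?_, ?_⟩
  · intro m
    have h1 := (hit m).coeff_zero 1
    have h2 := FormalMultilinearSeries.coeff_iterate_fslope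
      (p := binomialSeries ℝ (-((1 : ℝ) / q))) m 0
    rw [← hf] at h1
    simp only []
    rw [← h1]
    have h3 : (FormalMultilinearSeries.fslope^[m] (binomialSeries ℝ (-((1 : ℝ) / q)))) 0 1
      = (binomialSeries ℝ (-((1 : ℝ) / q))).coeff (0 + m) := h2
    rw [h3, FormalMultilinearSeries.coeff, binomialSeries_apply]
    simpa using aux_choose_ne q hq m
  · intro N
    refine ⟨(Function.swap dslope 0)^[N] f, ⟨_, hit N⟩, ?_⟩
    intro u
    induction N with
    | zero => simp [hf]
    | succ N ih =>
      rw [ih, Finset.sum_range_succ, Function.iterate_succ_apply']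
      have := sub_smul_dslope ((Function.swap dslope 0)^[N] f) 0 u
      simp only [sub_zero, smul_eq_mul] at this
      simp only [Function.swap] at this ⊢
      rw [pow_succ, mul_assoc (u ^ N) u, this]
      ring

lemma aux_contDiff (p q r : ℕ) (hep : Even p) : ContDiff ℝ ⊤ (phipq p q r) := by
  unfold phipq
  have hpos : ∀ x : ℝ, 0 < 1 + x ^ p := fun x => by
    have := hep.pow_nonneg x
    linarith
  refine ContDiff.div (by fun_prop) ?_ (fun x => (Real.rpow_pos_of_pos (hpos x) _).ne')
  exact ContDiff.rpow_const_of_ne (by fun_prop) (fun x => (hpos x).ne')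

lemma aux_vand (N p r : ℕ) (hp : 1 ≤ p) : ∃ v : ℕ → Fin N → ℝ, ∀ j < N, ∀ m < N,
    ∑ l : Fin N, v j l * ((l : ℝ) + 1) ^ (r + p * m) = if m = j then 1 else 0 := by
  set A : Matrix (Fin N) (Fin N) ℝ := fun l m => ((l : ℝ) + 1) ^ (r + p * (m : ℕ)) with hA
  have hAe : A = Matrix.diagonal (fun l : Fin N => ((l : ℝ) + 1) ^ r) *
      Matrix.vandermonde (fun l : Fin N => ((l : ℝ) + 1) ^ p) := by
    ext l m
    simp [hA, Matrix.diagonal_mul, Matrix.vandermonde_apply, pow_add, pow_mul]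
  have hdet : IsUnit A.det := by
    rw [isUnit_iff_ne_zero, hAe, Matrix.det_mul, Matrix.det_diagonal]
    refine mul_ne_zero (Finset.prod_ne_zero_iff.mpr fun l _ => by positivity) ?_
    rw [Matrix.det_vandermonde_ne_zero_iff]
    intro a b hab
    simp only at hab
    have := (pow_left_inj₀ (by positivity) (by positivity) (by omega)).mp hab
    have h2 : (a : ℝ) = b := by linarith
    exact Fin.ext (by exact_mod_cast h2)
  refine ⟨fun j l => if h : j < N then A⁻¹ ⟨j, h⟩ l else 0, ?_⟩
  intro j hj m hm
  have := congrFun (congrFun (Matrix.nonsing_inv_mul A hdet) ⟨j, hj⟩) ⟨m, hm⟩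
  rw [Matrix.mul_apply, Matrix.one_apply] at this
  simp only [hj, dif_pos]
  simpa [hA, eq_comm] using this

open Filter Topology in
lemma aux_small (N n : ℕ) (hn : n < N) (f H : ℝ → ℝ) (hH : AnalyticAt ℝ H 0)
    (hf : f =ᶠ[𝓝 0] fun x => x ^ N * H x) (hs : ContDiff ℝ ⊤ f) (i : ℕ) (M : ℝ) (hM : 0 < M)
    (a : ℝ) (ha : 0 < a) (δ : ℝ) (hδ : 0 < δ) :
    ∀ᶠ h in 𝓝[>] (0 : ℝ), ∀ y ∈ Set.Icc (-M) M,
      |iteratedDeriv i (fun z => f (h * a * z)) y| ≤ δ * h ^ n := by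
  obtain ⟨C, hC, hb⟩ := aux_bound N f H hH hf i
  obtain ⟨ρ, hρ, hball⟩ := Metric.eventually_nhds_iff.mp hb
  set K : ℝ := C * (a ^ i * (a * M) ^ (N - i)) with hK
  have hK0 : 0 ≤ K := by positivity
  have e1 : ∀ᶠ h in 𝓝[>] (0 : ℝ), h < 1 := nhdsWithin_le_nhds (gt_mem_nhds one_pos)
  have e2 : ∀ᶠ h in 𝓝[>] (0 : ℝ), h < ρ / (a * M) :=
    nhdsWithin_le_nhds (gt_mem_nhds (by positivity))
  have e3 : ∀ᶠ h in 𝓝[>] (0 : ℝ), h < δ / (K + 1) :=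
    nhdsWithin_le_nhds (gt_mem_nhds (by positivity))
  filter_upwards [e1, e2, e3, self_mem_nhdsWithin] with h h1 h2 h3 h0 y hy
  have h0 : 0 < h := h0
  have hyM : |y| ≤ M := abs_le.mpr hy
  rw [iteratedDeriv_comp_const_mul (hs.of_le le_top)]
  have hle : |h * a * y| ≤ h * (a * M) := by
    rw [abs_mul, abs_of_pos (by positivity : 0 < h * a), mul_assoc]
    gcongr
  have hlt : h * (a * M) < ρ := by
    rwa [lt_div_iff₀ (by positivity)] at h2
  have hx := @hball (h * a * y) (by rw [Real.dist_eq, sub_zero]; linarith)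
  rw [abs_mul, abs_of_pos (by positivity : 0 < (h * a) ^ i)]
  calc (h * a) ^ i * |iteratedDeriv i f (h * a * y)|
      ≤ (h * a) ^ i * (C * (h * (a * M)) ^ (N - i)) := by
        gcongr
        exact hx.trans (by gcongr)
    _ = K * h ^ (i + (N - i)) := by rw [hK, mul_pow, mul_pow, pow_add]; ring
    _ ≤ K * h ^ (n + 1) := by
        gcongr ?_ * ?_
        exact pow_le_pow_of_le_one h0.le h1.le (by omega)
    _ = (K * h) * h ^ n := by ring
    _ ≤ δ * h ^ n := by
        gcongr
        rw [lt_div_iff₀ (by positivity)] at h3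
        nlinarith

/-- Simultaneous approximation, in `W^{k,∞}([−M,M])`, of all the monomials `y^n` with
`n ∈ S_{p,q} = {r + pj : j ∈ ℕ₀}`, `n ≤ s`, by the output coordinates of a single shallow
`φ_{p,q}`-network `Ψ(y) = V φ(wy + b) + c` of width `(s+1)/2`: the `(n+1)/2`-th output
coordinate is `ε`-close to `y^n`. -/
theorem shallow_phipqNet_approximates_monomials (p q r : ℕ) (hep : Even p) (heq : Even q)
    (hq : 1 ≤ q) (hpq : q ≤ p) (hr : p = q * r) (hodd : Odd r)
    (k : ℕ) (M : ℝ) (hM : 0 < M) (s : ℕ) (hsS : ∃ j : ℕ, s = r + p * j)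
    (hsodd : s % 2 = 1) (ε : ℝ) (hε : 0 < ε) :
    ∃ (w b : Fin ((s + 1) / 2) → ℝ) (V : Matrix (Fin ((s + 1) / 2)) (Fin ((s + 1) / 2)) ℝ)
      (c : Fin ((s + 1) / 2) → ℝ),
      ∀ n : ℕ, (∃ j : ℕ, n = r + p * j) → ∀ hn : n ≤ s, ∀ i : ℕ, i ≤ k →
        ∀ y ∈ Set.Icc (-M) M,
          |iteratedDeriv i (fun z : ℝ => z ^ n -
              ((∑ j', V ⟨(n - 1) / 2, by omega⟩ j' * phipq p q r (w j' * z + b j')) +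
                c ⟨(n - 1) / 2, by omega⟩)) y| ≤ ε := by
  obtain ⟨js, hjs⟩ := hsS
  have hr1 : 1 ≤ r := hodd.pos
  have hp2 : 2 ≤ p := by
    obtain ⟨t, ht⟩ := hep
    omega
  obtain ⟨N, hN⟩ : ∃ N, N = (s + 1) / 2 := ⟨_, rfl⟩
  obtain ⟨c, hc, hexp⟩ := aux_expand q hq
  obtain ⟨G, hG, hGe⟩ := hexp N
  obtain ⟨v, hv⟩ := aux_vand N p r (by omega)
  set R : ℝ → ℝ := fun x => phipq p q r x - ∑ m ∈ Finset.range N, c m * x ^ (r + p * m) with hR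
  have hRs : ContDiff ℝ ⊤ R := by
    refine (aux_contDiff p q r hep).sub ?_
    fun_prop
  have hRe : R = fun x => x ^ (r + p * N) * G (x ^ p) := by
    funext x
    have hpos : 0 ≤ 1 + x ^ p := by
      have := hep.pow_nonneg x
      linarith
    have h1 : phipq p q r x = x ^ r * (1 + x ^ p) ^ (-((1 : ℝ) / q)) := by
      rw [phipq, Real.rpow_neg hpos, div_eq_mul_inv]
    simp only [hR]
    rw [h1, hGe, mul_add, Finset.mul_sum]
    have h2 : ∀ m, x ^ r * (c m * (x ^ p) ^ m) = c m * x ^ (r + p * m) := fun m => by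
      rw [pow_add, pow_mul]; ring
    simp only [h2]
    rw [pow_add, pow_mul]; ring
  have hGp : AnalyticAt ℝ (fun x : ℝ => G (x ^ p)) 0 := by
    refine AnalyticAt.fun_comp (g := G) (f := fun x : ℝ => x ^ p) ?_ (by fun_prop)
    simpa [show p ≠ 0 by omega] using hG
  have key : ∀ᶠ h in nhdsWithin (0 : ℝ) (Set.Ioi 0), ∀ j ∈ Finset.range N,
      ∀ i ∈ Finset.range (k + 1), ∀ l : Fin N, ∀ y ∈ Set.Icc (-M) M,
      |iteratedDeriv i (fun z => R (h * ((l : ℝ) + 1) * z)) y| ≤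
        ε * |c j| / (∑ l, |v j l| + 1) * h ^ (r + p * j) := by
    rw [Filter.eventually_all_finset]
    intro j hj
    rw [Filter.eventually_all_finset]
    intro i hi
    rw [Filter.eventually_all]
    intro l
    have hsum : 0 ≤ ∑ l, |v j l| := Finset.sum_nonneg fun _ _ => abs_nonneg _
    have hcj := abs_pos.mpr (hc j)
    refine aux_small (r + p * N) (r + p * j) ?_ R _ hGp (by rw [hRe]) hRs i M hM _
      (by positivity) _ (by positivity)
    have := Finset.mem_range.mp hj
    have := Nat.mul_lt_mul_of_pos_left this (show 0 < p by omega)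
    omega
  obtain ⟨h, hkey, hh⟩ := (key.and self_mem_nhdsWithin).exists
  have hh : 0 < h := hh
  subst hN
  refine ⟨fun l => h * ((l : ℝ) + 1), fun _ => 0,
    fun a l => v ((2 * (a : ℕ) + 1 - r) / p) l / (c ((2 * (a : ℕ) + 1 - r) / p) * h ^ (2 * (a : ℕ) + 1)),
    fun _ => 0, ?_⟩
  rintro n ⟨j, hj⟩ hn i hi y hy
  have hnodd : 2 * ((n - 1) / 2) + 1 = n := by
    obtain ⟨t, ht⟩ := hodd
    obtain ⟨t', ht'⟩ := hep
    have : p * j = 2 * (t' * j) := by rw [ht']; ring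
    omega
  have hjq : (n - r) / p = j := by
    rw [hj, Nat.add_sub_cancel_left, Nat.mul_div_cancel_left _ (by omega)]
  have hjN : j < (s + 1) / 2 := by
    have : 2 * j ≤ p * j := Nat.mul_le_mul_right _ hp2
    omega
  simp only [hnodd, hjq, add_zero]
  have hcj := hc j
  have hfun : (fun z : ℝ => z ^ n - ∑ l, v j l / (c j * h ^ n) * phipq p q r (h * ((l : ℝ) + 1) * z))
      = fun z : ℝ => ∑ l, (-(v j l / (c j * h ^ n))) * R (h * ((l : ℝ) + 1) * z) := by
    funext z
    have hmain : ∑ l, v j l / (c j * h ^ n) *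
        ∑ m ∈ Finset.range ((s + 1) / 2), c m * (h * ((l : ℝ) + 1) * z) ^ (r + p * m) = z ^ n := by
      simp only [Finset.mul_sum]
      rw [Finset.sum_comm]
      have : ∀ m ∈ Finset.range ((s + 1) / 2),
          ∑ l, v j l / (c j * h ^ n) * (c m * (h * ((l : ℝ) + 1) * z) ^ (r + p * m))
          = if m = j then z ^ n else 0 := by
        intro m hm
        have hvm := hv j hjN m (Finset.mem_range.mp hm)
        have e : ∀ l : Fin ((s + 1) / 2),
            v j l / (c j * h ^ n) * (c m * (h * ((l : ℝ) + 1) * z) ^ (r + p * m))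
            = (c m * h ^ (r + p * m) * z ^ (r + p * m) / (c j * h ^ n)) *
              (v j l * ((l : ℝ) + 1) ^ (r + p * m)) := by
          intro l
          rw [mul_pow, mul_pow]; ring
        simp only [e]
        rw [← Finset.mul_sum, hvm]
        split_ifs with hmj
        · subst hmj
          rw [← hj]
          field_simp
        · simp
      rw [Finset.sum_congr rfl this]
      simp [hjN]
    rw [← hmain, ← Finset.sum_sub_distrib]
    refine Finset.sum_congr rfl fun l _ => ?_
    simp only [hR]
    ring
  rw [hfun, iteratedDeriv_fun_sum]
  swap
  · intro l _
    have h1 : ContDiff ℝ i R := hRs.of_le le_top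
    exact (contDiff_const.mul (h1.comp (by fun_prop))).contDiffAt
  have hsum : 0 ≤ ∑ l, |v j l| := Finset.sum_nonneg fun _ _ => abs_nonneg _
  have hcp := abs_pos.mpr hcj
  calc |∑ l, iteratedDeriv i (fun z => (-(v j l / (c j * h ^ n))) * R (h * ((l : ℝ) + 1) * z)) y|
      ≤ ∑ l, |iteratedDeriv i (fun z => (-(v j l / (c j * h ^ n))) * R (h * ((l : ℝ) + 1) * z)) y| :=
        Finset.abs_sum_le_sum_abs _ _
    _ ≤ ∑ l, |v j l| * (ε / (∑ l, |v j l| + 1)) := by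
        refine Finset.sum_le_sum fun l _ => ?_
        rw [iteratedDeriv_const_mul_field, abs_mul, abs_neg, abs_div, abs_mul, abs_of_pos (pow_pos hh n)]
        have hk := hkey j (Finset.mem_range.mpr hjN) i (Finset.mem_range.mpr (by omega)) l y hy
        rw [← hj] at hk
        calc _ ≤ |v j l| / (|c j| * h ^ n) * (ε * |c j| / (∑ l, |v j l| + 1) * h ^ n) := by gcongr
          _ = _ := by field_simp
    _ = ε * ((∑ l, |v j l|) / (∑ l, |v j l| + 1)) := by rw [← Finset.sum_mul]; ring
    _ ≤ ε * 1 := by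
        gcongr
        rw [div_le_one (by positivity)]
        linarith
    _ = ε := mul_one _
end
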